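/- For all partitions α, β and all nonnegative integers m, n: Σ_λ f^{λ/α}(p) f^{λ/β}(q), summed over partitions λ with λ/α ⊢ m and λ/β ⊢ n, equals Σ_{k ≥ 0} [m choose k]_p · [n choose k]_q · A_k(p,q) · Σ_μ f^{β/μ}(p) f^{α/μ}(q), where the inner sum is over partitions μ with β/μ ⊢ m-k and α/μ ⊢ n-k. -/

import Mathlib

open Finset

namespace QT

/-- The major index of a permutation of `Fin n` (sum of descents,
with positions written `1,...,n-1` as in one-line notation). -/
def maj {n : ℕ} (π : Equiv.Perm (Fin n)) : ℕ :=
  ∑ i ∈ Finset.range n,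
    if h : i + 1 < n then
      (if π ⟨i + 1, h⟩ < π ⟨i, by omega⟩ then i + 1 else 0)
    else 0

/-- `imaj π = maj π⁻¹`. -/
def imaj {n : ℕ} (π : Equiv.Perm (Fin n)) : ℕ := maj π⁻¹

/-- The permutation of `Fin k` order-isomorphic to the word `v 0, v 1, ..., v (k-1)`. -/
noncomputable def standardize {n k : ℕ} (v : Fin k → Fin n) (hv : Function.Injective v) :
    Equiv.Perm (Fin k) :=
  Equiv.ofBijective
    (fun i => (Finset.orderIsoOfFin (Finset.image v Finset.univ)
        (by rw [Finset.card_image_of_injective _ hv, Finset.card_univ, Fintype.card_fin])).symm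
        ⟨v i, Finset.mem_image_of_mem v (Finset.mem_univ i)⟩)
    (Finite.injective_iff_bijective.mp (fun i j hij => by
      have h2 := (Finset.orderIsoOfFin _ _).symm.injective hij
      exact hv (congrArg Subtype.val h2)))

/-- `π^{≤k}` : the permutation of `Fin k` order-isomorphic to the first `k` letters of `π`. -/
noncomputable def pInit {n : ℕ} (π : Equiv.Perm (Fin n)) (k : ℕ) (hk : k ≤ n) :
    Equiv.Perm (Fin k) :=
  standardize (fun i => π (Fin.castLE hk i))
    (fun i j h => Fin.castLE_injective hk (π.injective h))

/-- `π^{>k}` : the permutation of `Fin (n-k)` order-isomorphic to the last `n - k` letters of `π`. -/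
noncomputable def pTail {n : ℕ} (π : Equiv.Perm (Fin n)) (k : ℕ) :
    Equiv.Perm (Fin (n - k)) :=
  standardize (fun i => π ⟨k + (i : ℕ), by have := i.isLt; omega⟩)
    (fun i j h => by
      have h2 : k + (i : ℕ) = k + (j : ℕ) := congrArg Fin.val (π.injective h)
      exact Fin.ext (by omega))

/-- `π_{≤k}` : the permutation of `Fin k` order-isomorphic to the subword of `π`
consisting of the `k` smallest values.  (Equivalently `((π⁻¹)^{≤k})⁻¹`.) -/
noncomputable def vLow {n : ℕ} (π : Equiv.Perm (Fin n)) (k : ℕ) (hk : k ≤ n) :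
    Equiv.Perm (Fin k) := (pInit π⁻¹ k hk)⁻¹

/-- `π_{>k}` : the permutation of `Fin (n-k)` order-isomorphic to the subword of `π`
consisting of the values `> k`.  (Equivalently `((π⁻¹)^{>k})⁻¹`.) -/
noncomputable def vHigh {n : ℕ} (π : Equiv.Perm (Fin n)) (k : ℕ) :
    Equiv.Perm (Fin (n - k)) := (pTail π⁻¹ k)⁻¹

/-- The set `I_n` of involutions in `S_n`. -/
def involutions (n : ℕ) : Finset (Equiv.Perm (Fin n)) :=
  Finset.univ.filter fun π => π * π = 1

-- `I_n(σ) = {π ∈ I_n : π_{≤m} = σ}`.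
open scoped Classical in
noncomputable def involutionsC (n : ℕ) {m : ℕ} (σ : Equiv.Perm (Fin m)) :
    Finset (Equiv.Perm (Fin n)) :=
  (involutions n).filter fun π => ∃ h : m ≤ n, vLow π m h = σ

-- `S_n(σ,τ) = {π ∈ S_n : π_{≤a} = σ, π^{≤b} = τ}`.
open scoped Classical in
noncomputable def permsC (n : ℕ) {a b : ℕ} (σ : Equiv.Perm (Fin a)) (τ : Equiv.Perm (Fin b)) :
    Finset (Equiv.Perm (Fin n)) :=
  Finset.univ.filter fun π => ∃ (ha : a ≤ n) (hb : b ≤ n), vLow π a ha = σ ∧ pInit π b hb = τ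

-- The j-set `J(σ) = {j : σ^{≤j} is an involution}`.
open scoped Classical in
noncomputable def jSet {m : ℕ} (σ : Equiv.Perm (Fin m)) : Finset ℕ :=
  (Finset.range (m + 1)).filter fun j => ∃ h : j ≤ m, pInit σ j h * pInit σ j h = 1

-- The j₂-set `J(σ,τ) = {j : σ^{≤j} = τ_{≤j}}`.
open scoped Classical in
noncomputable def j2Set {a b : ℕ} (σ : Equiv.Perm (Fin a)) (τ : Equiv.Perm (Fin b)) :
    Finset ℕ :=
  (Finset.range (min a b + 1)).filter fun j =>
    ∃ (ha : j ≤ a) (hb : j ≤ b), pInit σ j ha = vLow τ j hb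

/-- A set of nonnegative integers is a j₂-set if it is `J(σ,τ)` for some pair of
permutations. -/
def IsJ2Set (S : Finset ℕ) : Prop :=
  ∃ (a b : ℕ) (σ : Equiv.Perm (Fin a)) (τ : Equiv.Perm (Fin b)), S = j2Set σ τ

-- The number of j₂-sets with largest element `n`.
open scoped Classical in
noncomputable def j2count (n : ℕ) : ℕ :=
  ((Finset.range (n + 1)).powerset.filter
    fun S => IsJ2Set S ∧ n ∈ S ∧ ∀ x ∈ S, x ≤ n).card

/-- `[n]_q = 1 + q + ⋯ + q^{n-1}`. -/
def qInt (q : ℝ) (n : ℕ) : ℝ := ∑ i ∈ Finset.range n, q ^ i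

/-- The q-factorial `[n]_q! = ∏_{i=1}^n (1 + q + ⋯ + q^{i-1})`. -/
def qFact (q : ℝ) (n : ℕ) : ℝ := ∏ i ∈ Finset.range n, qInt q (i + 1)

/-- The Gaussian binomial coefficient `[n choose k]_q = [n]_q!/([k]_q! [n-k]_q!)`,
defined via the q-Pascal recursion. -/
def qBinom (q : ℝ) : ℕ → ℕ → ℝ
  | _, 0 => 1
  | 0, _ + 1 => 0
  | n + 1, k + 1 => qBinom q n k + q ^ (k + 1) * qBinom q n (k + 1)

/-- `t_n(q) = Σ_{π ∈ I_n} q^{maj π}`. -/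
noncomputable def tq (q : ℝ) (n : ℕ) : ℝ := ∑ π ∈ involutions n, q ^ maj π

/-- `A_n(p,q) = Σ_{π ∈ S_n} p^{imaj π} q^{maj π}`. -/
noncomputable def Apq (p q : ℝ) (n : ℕ) : ℝ :=
  ∑ π : Equiv.Perm (Fin n), p ^ imaj π * q ^ maj π



/-- The `k × k` square Young diagram. -/
def square (k : ℕ) : YoungDiagram :=
  ⟨Finset.range k ×ˢ Finset.range k, by
    intro a b hab ha
    rw [Finset.mem_coe, Finset.mem_product] at ha ⊢
    simp only [Finset.mem_range] at ha ⊢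
    exact ⟨lt_of_le_of_lt hab.1 ha.1, lt_of_le_of_lt hab.2 ha.2⟩⟩

-- All Young diagrams contained in `l`.
open scoped Classical in
noncomputable def subDiagrams (l : YoungDiagram) : Finset YoungDiagram :=
  (l.cells.powerset.filter fun (s : Finset (ℕ × ℕ)) => IsLowerSet ((s : Set (ℕ × ℕ)))).attach.image
    fun s => YoungDiagram.mk s.1 (by
      have hs := s.2
      rw [Finset.mem_filter] at hs
      exact hs.2)

/-- All Young diagrams with `k` cells (i.e. partitions of `k`). -/
noncomputable def diagramsOfCard (k : ℕ) : Finset YoungDiagram :=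
  (subDiagrams (square k)).filter fun d => d.card = k

/-- A chain of Young diagrams each obtained from the previous by adding one cell.
Such chains of length `n` starting at `μ` and ending at `λ` are exactly the skew standard
Young tableaux of shape `λ/μ` with `n` cells. -/
def IsSYTChain {n : ℕ} (c : Fin (n + 1) → YoungDiagram) : Prop :=
  ∀ i : ℕ, ∀ _h : i < n,
    c ⟨i, by omega⟩ ≤ c ⟨i + 1, by omega⟩ ∧
      (c ⟨i + 1, by omega⟩).card = (c ⟨i, by omega⟩).card + 1

-- The (skew) standard Young tableaux of shape `λ/μ` and size `n`, encoded as chains.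
open scoped Classical in
noncomputable def skewSYT (mu lam : YoungDiagram) (n : ℕ) :
    Finset (Fin (n + 1) → YoungDiagram) :=
  (Fintype.piFinset fun _ : Fin (n + 1) => subDiagrams lam).filter
    fun c => c 0 = mu ∧ c (Fin.last n) = lam ∧ IsSYTChain c

-- `T_n` : all standard Young tableaux of size `n` (encoded as chains starting at `⊥`).
open scoped Classical in
noncomputable def allSYT (n : ℕ) : Finset (Fin (n + 1) → YoungDiagram) :=
  (Fintype.piFinset fun _ : Fin (n + 1) => subDiagrams (square n)).filter
    fun c => c 0 = ⊥ ∧ IsSYTChain c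

/-- The row in which the `(i+1)`-st cell of the chain `c` is added. -/
def rowOfStep {n : ℕ} (c : Fin (n + 1) → YoungDiagram) (i : ℕ) : ℕ :=
  if h : i < n then
    ((c ⟨i + 1, by omega⟩).cells \ (c ⟨i, by omega⟩).cells).sup Prod.fst
  else 0

/-- The major index of a (skew) standard Young tableau, encoded as a chain:
the sum of all `i` such that `i+1` lies in a lower row than `i`. -/
def chainMaj {n : ℕ} (c : Fin (n + 1) → YoungDiagram) : ℕ :=
  ∑ i ∈ Finset.range n,
    if i + 1 < n ∧ rowOfStep c i < rowOfStep c (i + 1) then i + 1 else 0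

/-- `f^{λ/μ}(q) = Σ_{sh(T) = λ/μ} q^{maj T}`, where `n` is the number of cells of `λ/μ`. -/
noncomputable def fSkew (mu lam : YoungDiagram) (n : ℕ) (q : ℝ) : ℝ :=
  ∑ c ∈ skewSYT mu lam n, q ^ chainMaj c

/-- `T_{>m}` : the skew tableau obtained from `T` by removing the entries `≤ m`. -/
def tailChain {n : ℕ} (c : Fin (n + 1) → YoungDiagram) (m : ℕ) :
    Fin (n - m + 1) → YoungDiagram :=
  fun i => c ⟨min (m + (i : ℕ)) n, by omega⟩

/-- `T` contains `A`, i.e. `T_{≤a} = A`. -/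
def containsT {n a : ℕ} (T : Fin (n + 1) → YoungDiagram)
    (A : Fin (a + 1) → YoungDiagram) : Prop :=
  ∀ i : Fin (a + 1), T ⟨min (i : ℕ) n, by omega⟩ = A i

-- `T_n(A,B)` : pairs of standard Young tableaux of the same shape, of size `n`,
-- containing `A` and `B` respectively.
open scoped Classical in
noncomputable def pairSYT (n : ℕ) {a b : ℕ} (A : Fin (a + 1) → YoungDiagram)
    (B : Fin (b + 1) → YoungDiagram) :
    Finset ((Fin (n + 1) → YoungDiagram) × (Fin (n + 1) → YoungDiagram)) :=
  ((allSYT n) ×ˢ (allSYT n)).filter fun PQ =>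
    PQ.1 (Fin.last n) = PQ.2 (Fin.last n) ∧ containsT PQ.1 A ∧ containsT PQ.2 B

/-- The empty standard Young tableau. -/
def emptySYT : Fin (0 + 1) → YoungDiagram := fun _ => ⊥

/-- Schensted row insertion: insert `x` into the row `r`, returning the new row and
the bumped entry (if any). -/
def insertRow : List ℕ → ℕ → List ℕ × Option ℕ
  | [], x => ([x], none)
  | y :: ys, x =>
    if x < y then (x :: ys, some y)
    else
      let p := insertRow ys x
      (y :: p.1, p.2)

/-- Schensted insertion of `x` into a tableau given as a list of rows. -/
def insertTab : List (List ℕ) → ℕ → List (List ℕ)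
  | [], x => [[x]]
  | r :: rs, x =>
    match insertRow r x with
    | (r', none) => r' :: rs
    | (r', some y) => r' :: insertTab rs y

/-- The Robinson–Schensted insertion tableau of a word. -/
def Ptab (w : List ℕ) : List (List ℕ) := w.foldl insertTab []

/-- The Young diagram with row lengths `r` (junk-robust version). -/
def diagramOfRows (r : List ℕ) : YoungDiagram :=
  ⟨(Finset.range r.length ×ˢ Finset.range (r.foldr max 0)).filter
      (fun p => ∀ i ≤ p.1, p.2 < r.getD i 0), by
    intro a b hab ha
    rw [Finset.mem_coe, Finset.mem_filter, Finset.mem_product] at ha ⊢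
    obtain ⟨⟨h1, h2⟩, h3⟩ := ha
    simp only [Finset.mem_range] at h1 h2 ⊢
    refine ⟨⟨lt_of_le_of_lt hab.1 h1, lt_of_le_of_lt hab.2 h2⟩, fun i hi => ?_⟩
    exact lt_of_le_of_lt hab.2 (h3 i (le_trans hi hab.1))⟩

/-- The shape of the Robinson–Schensted insertion tableau of a word. -/
def RSshape (w : List ℕ) : YoungDiagram := diagramOfRows ((Ptab w).map List.length)

/-- The one-line word of a permutation of `Fin a` (with values `0,…,a-1`). -/
def wordOf {a : ℕ} (σ : Equiv.Perm (Fin a)) : List ℕ :=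
  (List.finRange a).map fun i => (σ i : ℕ)

/-- The chain encoding of the Robinson–Schensted insertion tableau `P(σ)`:
its `i`-th diagram is the shape of the subtableau of `P(σ)` with entries `≤ i`,
which equals the RS-shape of the subword of `σ` with values `≤ i`. -/
def Pchain {a : ℕ} (σ : Equiv.Perm (Fin a)) : Fin (a + 1) → YoungDiagram :=
  fun i => RSshape ((wordOf σ).filter fun x => x < (i : ℕ))

/-- The chain encoding of the Robinson–Schensted recording tableau `Q(σ)`:
its `i`-th diagram is the shape of the subtableau of `Q(σ)` with entries `≤ i`,
which equals the RS-shape of the prefix of `σ` of length `i`. -/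
def Qchain {a : ℕ} (σ : Equiv.Perm (Fin a)) : Fin (a + 1) → YoungDiagram :=
  fun i => RSshape ((wordOf σ).take (i : ℕ))

theorem skew_commutation_lift {R : Type*} [Ring R] [Algebra ℝ R] {p : ℝ}
    (hp : ∀ m, 0 < m → p ^ m ≠ 1) {P D G : ℕ → R} {e a : ℕ → ℝ}
    (hP : ∀ m, P m = ∑ x ∈ antidiagonal m, p ^ x.1 • (P x.1 * D x.2))
    (hP0 : P 0 = 1) (hD0 : D 0 = 1) (he0 : e 0 = 1) (ha0 : a 0 = 1)
    (hDG : ∀ j n, D j * G n = ∑ k ∈ range (min j n + 1), e k • (G (n - k) * D (j - k)))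
    (ha : ∀ k, a k = ∑ x ∈ antidiagonal k, p ^ x.1 * a x.1 * e x.2) (m n : ℕ) :
    P m * G n = ∑ k ∈ range (min m n + 1), a k • (G (n - k) * P (m - k)) := by
  set B : ℕ → ℕ → R := fun m n => ∑ k ∈ range (min m n + 1), a k • (G (n - k) * P (m - k))
    with hB
  have key : ∀ m n, ∑ x ∈ antidiagonal m, p ^ x.1 •
      ∑ k ∈ range (min x.2 n + 1), e k • (B x.1 (n - k) * D (x.2 - k)) = B m n := by
    intro m n
    have h1 : B m n = ∑ s ∈ range (min m n + 1), ∑ y ∈ antidiagonal s,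
        ∑ z ∈ antidiagonal (m - s), (p ^ y.1 * a y.1 * e y.2 * p ^ z.1) •
          (G (n - s) * (P z.1 * D z.2)) := by
      simp only [hB]
      refine sum_congr rfl fun s _ => ?_
      rw [ha s, hP (m - s), sum_smul]
      refine sum_congr rfl fun y _ => ?_
      rw [mul_sum, smul_sum]
      refine sum_congr rfl fun z _ => ?_
      rw [mul_smul_comm, smul_smul]
    rw [h1]
    simp only [hB, smul_sum, sum_mul]
    simp only [sum_sigma']
    refine sum_nbij' (fun x => ⟨x.2.1 + x.2.2, (x.2.2, x.2.1), (x.1.1 - x.2.2, x.1.2 - x.2.1)⟩)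
      (fun x => ⟨(x.2.1.1 + x.2.2.1, x.2.1.2 + x.2.2.2), x.2.1.2, x.2.1.1⟩) ?_ ?_ ?_ ?_ ?_
    · rintro ⟨⟨i, j⟩, k, l⟩ h
      simp only [mem_sigma, HasAntidiagonal.mem_antidiagonal, mem_range] at h ⊢
      omega
    · rintro ⟨s, ⟨l, k⟩, i, j⟩ h
      simp only [mem_sigma, HasAntidiagonal.mem_antidiagonal, mem_range] at h ⊢
      omega
    · rintro ⟨⟨i, j⟩, k, l⟩ h
      simp only [mem_sigma, HasAntidiagonal.mem_antidiagonal, mem_range] at h ⊢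
      have e1 : l + (i - l) = i := by omega
      have e2 : k + (j - k) = j := by omega
      simp [e1, e2]
    · rintro ⟨s, ⟨l, k⟩, i, j⟩ h
      simp only [mem_sigma, HasAntidiagonal.mem_antidiagonal, mem_range] at h ⊢
      obtain ⟨h1, rfl, h3⟩ := h
      simp [add_comm k l]
    · rintro ⟨⟨i, j⟩, k, l⟩ h
      simp only [mem_sigma, HasAntidiagonal.mem_antidiagonal, mem_range] at h ⊢
      have e1 : l + (i - l) = i := by omega
      rw [smul_mul_assoc, smul_smul, smul_smul, mul_assoc, Nat.sub_sub]
      congr 1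
      · nth_rewrite 1 [← e1]
        rw [pow_add]; ring
      · rw [mul_assoc]
  suffices P m * G n = B m n from this
  induction m using Nat.strong_induction_on generalizing n with
  | _ m ih =>
    rcases Nat.eq_zero_or_pos m with rfl | hm
    · simp [hB, hP0, ha0]
    have h2 : P m * G n = ∑ x ∈ antidiagonal m, p ^ x.1 •
        ∑ k ∈ range (min x.2 n + 1), e k • (P x.1 * G (n - k) * D (x.2 - k)) := by
      conv_lhs => rw [hP m]
      rw [sum_mul]
      refine sum_congr rfl fun x _ => ?_
      rw [smul_mul_assoc, mul_assoc, hDG, mul_sum]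
      simp only [mul_smul_comm, mul_assoc]
    have hk := key m n
    obtain ⟨m, rfl⟩ : ∃ m', m = m' + 1 := ⟨m - 1, by omega⟩
    rw [Nat.sum_antidiagonal_succ'] at h2 hk
    have h3 : ∑ x ∈ antidiagonal m, p ^ x.1 •
        ∑ k ∈ range (min (x.2 + 1) n + 1), e k • (P x.1 * G (n - k) * D (x.2 + 1 - k)) =
        ∑ x ∈ antidiagonal m, p ^ x.1 •
        ∑ k ∈ range (min (x.2 + 1) n + 1), e k • (B x.1 (n - k) * D (x.2 + 1 - k)) := by
      refine sum_congr rfl fun x hx => ?_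
      have := HasAntidiagonal.mem_antidiagonal.1 hx
      simp only [ih x.1 (by omega)]
    simp [he0, hD0] at h2 hk
    rw [h3] at h2
    have h4 : (1 - p ^ (m + 1)) • (P (m + 1) * G n) = (1 - p ^ (m + 1)) • B (m + 1) n := by
      rw [sub_smul, sub_smul, one_smul, one_smul]
      nth_rewrite 1 [h2]
      nth_rewrite 1 [← hk]
      abel
    exact smul_right_injective R (sub_ne_zero.2 (hp _ hm).symm) h4

/-- `(q; q)_n`. -/
def qPoch (q : ℝ) (n : ℕ) : ℝ := ∏ i ∈ range n, (1 - q ^ (i + 1))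

theorem qPoch_succ (q : ℝ) (n : ℕ) : qPoch q (n + 1) = qPoch q n * (1 - q ^ (n + 1)) :=
  prod_range_succ _ _

@[simp] theorem qPoch_zero (q : ℝ) : qPoch q 0 = 1 := rfl

theorem qPoch_ne_zero {q : ℝ} (hq : ∀ m, 0 < m → q ^ m ≠ 1) (n : ℕ) : qPoch q n ≠ 0 :=
  prod_ne_zero_iff.2 fun i _ => sub_ne_zero.2 (hq (i + 1) (by omega)).symm

theorem qBinom_zero_right (q : ℝ) (n : ℕ) : qBinom q n 0 = 1 := by cases n <;> rfl

theorem qBinom_succ_succ (q : ℝ) (n k : ℕ) :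
    qBinom q (n + 1) (k + 1) = qBinom q n k + q ^ (k + 1) * qBinom q n (k + 1) := rfl

theorem qBinom_eq_zero (q : ℝ) : ∀ {n k : ℕ}, n < k → qBinom q n k = 0
  | 0, k + 1, _ => rfl
  | n + 1, k + 1, h => by
    rw [qBinom_succ_succ, qBinom_eq_zero q (by omega), qBinom_eq_zero q (by omega)]; simp

theorem qBinom_self (q : ℝ) (n : ℕ) : qBinom q n n = 1 := by
  induction n with
  | zero => rfl
  | succ n ih => rw [qBinom_succ_succ, ih, qBinom_eq_zero q (Nat.lt_succ_self n)]; simp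

theorem qBinom_mul_qPoch (q : ℝ) (a b : ℕ) :
    qBinom q (a + b) a * (qPoch q a * qPoch q b) = qPoch q (a + b) := by
  induction h : a + b generalizing a b with
  | zero =>
    obtain ⟨rfl, rfl⟩ : a = 0 ∧ b = 0 := by omega
    simp [qBinom_self]
  | succ n ih =>
    rcases a with _ | a
    · obtain rfl : b = n + 1 := by omega
      simp [qBinom_zero_right]
    rcases b with _ | b
    · obtain rfl : a = n := by omega
      simp [qBinom_self]
    have h1 := ih a (b + 1) (by omega)
    have h2 := ih (a + 1) b (by omega)
    rw [qBinom_succ_succ, qPoch_succ q n, qPoch_succ q a, qPoch_succ q b]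
    rw [qPoch_succ] at h1 h2
    have e1 : n = a + b + 1 := by omega
    have e2 : q ^ (n + 1) = q ^ (a + 1) * q ^ (b + 1) := by rw [← pow_add]; congr 1; omega
    rw [e2]
    linear_combination (1 - q ^ (a + 1)) * h1 + q ^ (a + 1) * (1 - q ^ (b + 1)) * h2

theorem sum_pow_div_qPoch {q : ℝ} (hq : ∀ m, 0 < m → q ^ m ≠ 1) (k : ℕ) :
    (qPoch q k)⁻¹ = ∑ x ∈ antidiagonal k, q ^ x.1 * (qPoch q x.1)⁻¹ * 1 := by
  rw [Nat.sum_antidiagonal_eq_sum_range_succ (fun i _ => q ^ i * (qPoch q i)⁻¹ * 1)]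
  induction k with
  | zero => simp
  | succ k ih =>
    rw [sum_range_succ, ← ih]
    have := qPoch_ne_zero hq k
    have h2 := sub_ne_zero.2 (hq (k + 1) (by omega)).symm
    rw [qPoch_succ]
    field_simp
    ring

/-- `q ^ (n - j) * ((1 - q ^ (n - j + 1)) ⋯ (1 - q ^ n))` for `j ≤ n`. -/
def runCoeff (q : ℝ) : ℕ → ℕ → ℝ
  | n, 0 => q ^ n
  | 0, _ + 1 => 0
  | n + 1, j + 1 => (1 - q ^ (n + 1)) * runCoeff q n j

theorem runCoeff_zero_right (q : ℝ) (n : ℕ) : runCoeff q n 0 = q ^ n := by cases n <;> rfl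

theorem runCoeff_mul_qPoch (q : ℝ) (i j : ℕ) :
    runCoeff q (i + j) j * qPoch q i = q ^ i * qPoch q (i + j) := by
  induction j with
  | zero => simp [runCoeff_zero_right]
  | succ j ih =>
    rw [← add_assoc, runCoeff, qPoch_succ]
    linear_combination (1 - q ^ (i + j + 1)) * ih

section runs
variable {I L : Type*} (S : ℕ → I → Finset L) (nx : ℕ → I → L → I) (desc : I → L → Prop)
  [∀ a b, Decidable (desc a b)]

/-- The descent-free part of the path recursion, started from `F i`. -/
def runSum (F : ℕ → I → ℝ) (i : ℕ) : ℕ → I → ℝ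
  | 0, a => F i a
  | j + 1, a => ∑ b ∈ (S (i + j) a).filter (fun b => ¬ desc a b), runSum F i j (nx (i + j) a b)

theorem eq_sum_runCoeff_mul_runSum {q : ℝ} {F X : ℕ → I → ℝ}
    (hF : ∀ n a, F (n + 1) a = ∑ b ∈ S n a, X n (nx n a b))
    (hX0 : ∀ a, X 0 a = F 0 a)
    (hX : ∀ n a, X (n + 1) a =
      ∑ b ∈ S n a, q ^ (if desc a b then n + 1 else 0) * X n (nx n a b)) (n : ℕ) (a : I) :
    X n a = ∑ j ∈ range (n + 1), runCoeff q n j * runSum S nx desc F (n - j) j a := by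
  induction n generalizing a with
  | zero => simp [hX0, runSum, runCoeff_zero_right]
  | succ n ih =>
    have h1 : X (n + 1) a = q ^ (n + 1) * F (n + 1) a + (1 - q ^ (n + 1)) *
        ∑ b ∈ (S n a).filter (fun b => ¬ desc a b), X n (nx n a b) := by
      rw [hX, hF, mul_sum, sum_filter, mul_sum, ← sum_add_distrib]
      refine sum_congr rfl fun b _ => ?_
      split_ifs <;> ring
    rw [h1, sum_range_succ']
    simp only [runCoeff, runSum, Nat.sub_zero]
    rw [add_comm]
    congr 1
    simp only [ih]
    rw [sum_comm, mul_sum]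
    refine sum_congr rfl fun j hj => ?_
    have hj' : n - j + j = n := by have := mem_range.1 hj; omega
    rw [Nat.add_sub_add_right, hj', ← mul_sum, mul_assoc]

end runs

/-- Position `x` (with `0 < x < k`) is a descent of `τ`. -/
def permDes {k : ℕ} (τ : Equiv.Perm (Fin k)) (x : ℕ) : Bool :=
  decide (∃ h : x < k, 0 < x ∧ τ ⟨x, h⟩ < τ ⟨x - 1, by omega⟩)

/-- The sum of the descents `x < l` recorded by `D`. -/
def desWt (l : ℕ) (D : ℕ → Bool) : ℕ := ∑ x ∈ range l, if D x then x else 0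

/-- The descents of a word of length `l` with descents `D` after a new largest letter is inserted
at position `v`. -/
def insDes (l v : ℕ) (D : ℕ → Bool) (x : ℕ) : Bool :=
  if x < v then D x else if x = v then false else if x = v + 1 then decide (v < l) else D (x - 1)

theorem permDes_eq {k x : ℕ} (τ : Equiv.Perm (Fin k)) (h : x < k) (h0 : 0 < x) :
    permDes τ x = decide (τ ⟨x, h⟩ < τ ⟨x - 1, by omega⟩) := by
  simp [permDes, h, h0]

@[simp] theorem permDes_zero {k : ℕ} (τ : Equiv.Perm (Fin k)) : permDes τ 0 = false := by
  simp [permDes]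

theorem permDes_of_le {k x : ℕ} (τ : Equiv.Perm (Fin k)) (h : k ≤ x) : permDes τ x = false := by
  simp [permDes, h]

theorem maj_eq_desWt {k : ℕ} (τ : Equiv.Perm (Fin k)) : maj τ = desWt k (permDes τ) := by
  rcases k with _ | k
  · rfl
  rw [maj, desWt, sum_range_succ, sum_range_succ']
  simp only [lt_self_iff_false, dite_false, add_zero, ite_self]
  refine sum_congr rfl fun i hi => ?_
  have hi' : i + 1 < k + 1 := by have := mem_range.1 hi; omega
  simp [permDes, hi']

/-- Append a last letter `v` to the word of `σ`, shifting the letters `≥ v` up. -/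
noncomputable def permSnoc {n : ℕ} (σ : Equiv.Perm (Fin n)) (v : Fin (n + 1)) :
    Equiv.Perm (Fin (n + 1)) :=
  Equiv.ofBijective (Fin.snoc (α := fun _ => Fin (n + 1)) (fun i => v.succAbove (σ i)) v) <| by
    refine Finite.injective_iff_bijective.mp fun i j => ?_
    refine Fin.lastCases ?_ (fun i => ?_) i <;> refine Fin.lastCases ?_ (fun j => ?_) j
    · simp
    · simp [eq_comm (a := v), Fin.succAbove_ne]
    · simp [Fin.succAbove_ne]
    · simp

@[simp] theorem permSnoc_last {n : ℕ} (σ : Equiv.Perm (Fin n)) (v : Fin (n + 1)) :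
    permSnoc σ v (Fin.last n) = v := by simp [permSnoc]

@[simp] theorem permSnoc_castSucc {n : ℕ} (σ : Equiv.Perm (Fin n)) (v : Fin (n + 1)) (i : Fin n) :
    permSnoc σ v i.castSucc = v.succAbove (σ i) := by simp [permSnoc]

@[simp] theorem permSnoc_inv_self {n : ℕ} (σ : Equiv.Perm (Fin n)) (v : Fin (n + 1)) :
    (permSnoc σ v)⁻¹ v = Fin.last n := by
  rw [Equiv.Perm.inv_eq_iff_eq]; simp

@[simp] theorem permSnoc_inv_succAbove {n : ℕ} (σ : Equiv.Perm (Fin n)) (v : Fin (n + 1))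
    (i : Fin n) : (permSnoc σ v)⁻¹ (v.succAbove i) = (σ⁻¹ i).castSucc := by
  rw [Equiv.Perm.inv_eq_iff_eq]; simp

theorem permSnoc_bijective (n : ℕ) :
    Function.Bijective fun x : Fin (n + 1) × Equiv.Perm (Fin n) => permSnoc x.2 x.1 := by
  rw [Fintype.bijective_iff_injective_and_card]
  constructor
  · rintro ⟨v, σ⟩ ⟨w, τ⟩ h
    have h0 : permSnoc σ v = permSnoc τ w := h
    have h1 : v = w := by simpa using congrArg (fun π => π (Fin.last n)) h0
    subst h1
    have h2 : σ = τ := by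
      ext i
      have := congrArg (fun π => π i.castSucc) h0
      simp only [permSnoc_castSucc, Fin.succAbove_right_inj] at this
      rw [this]
    rw [h2]
  · simp [Fintype.card_perm, Nat.factorial_succ]

theorem sum_perm_succ {n : ℕ} (g : Equiv.Perm (Fin (n + 1)) → ℝ) :
    ∑ π, g π = ∑ v : Fin (n + 1), ∑ σ : Equiv.Perm (Fin n), g (permSnoc σ v) := by
  rw [← Fintype.sum_prod_type (fun x : Fin (n + 1) × Equiv.Perm (Fin n) => g (permSnoc x.2 x.1))]
  exact (Function.Bijective.sum_comp (permSnoc_bijective n) g).symm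

/-- The last letter of `σ` (and `0` for the empty permutation). -/
def lastVal {n : ℕ} (σ : Equiv.Perm (Fin n)) : ℕ :=
  if h : 0 < n then σ ⟨n - 1, by omega⟩ else 0

theorem lastVal_permSnoc {n : ℕ} (σ : Equiv.Perm (Fin n)) (v : Fin (n + 1)) :
    lastVal (permSnoc σ v) = v := by
  have : (⟨n, by omega⟩ : Fin (n + 1)) = Fin.last n := rfl
  simp [lastVal, this]

theorem maj_permSnoc {n : ℕ} (σ : Equiv.Perm (Fin n)) (v : Fin (n + 1)) :
    maj (permSnoc σ v) = maj σ + if (v : ℕ) ≤ lastVal σ then n else 0 := by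
  rcases n with _ | n
  · simp [maj]
  rw [maj_eq_desWt, maj_eq_desWt, desWt, sum_range_succ, desWt]
  have hc (x : ℕ) (h : x < n + 1) (h' : x < n + 2) :
      permSnoc σ v ⟨x, h'⟩ = v.succAbove (σ ⟨x, h⟩) := permSnoc_castSucc σ v ⟨x, h⟩
  congr 1
  · refine sum_congr rfl fun x hx => ?_
    have hx' := mem_range.1 hx
    rcases Nat.eq_zero_or_pos x with rfl | h0
    · simp
    have : permDes (permSnoc σ v) x = permDes σ x := by
      rw [permDes_eq _ (by omega) h0, permDes_eq _ hx' h0, hc x hx', hc (x - 1) (by omega)]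
      simp
    rw [this]
  · have : permDes (permSnoc σ v) (n + 1) = decide ((v : ℕ) ≤ lastVal σ) := by
      have hl : permSnoc σ v ⟨n + 1, by omega⟩ = v := permSnoc_last σ v
      rw [permDes_eq _ (by omega) (by omega), hl, hc (n + 1 - 1) (by omega)]
      simp only [Fin.lt_succAbove_iff_le_castSucc, lastVal, Nat.zero_lt_succ, dif_pos]
      rfl
    rw [this]; simp

theorem permDes_permSnoc_inv {n : ℕ} (σ : Equiv.Perm (Fin n)) (v : Fin (n + 1)) :
    permDes (permSnoc σ v)⁻¹ = insDes n v (permDes σ⁻¹) := by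
  funext x
  have below (x : ℕ) (h : x < v) (h1 : x < n + 1) (h2 : x < n) :
      (permSnoc σ v)⁻¹ ⟨x, h1⟩ = (σ⁻¹ ⟨x, h2⟩).castSucc := by
    rw [← permSnoc_inv_succAbove σ v, Fin.succAbove_of_castSucc_lt _ _
      (by simpa [Fin.lt_def] using h)]
    rfl
  have above (x : ℕ) (h : v < x) (h1 : x < n + 1) (h2 : x - 1 < n) :
      (permSnoc σ v)⁻¹ ⟨x, h1⟩ = (σ⁻¹ ⟨x - 1, h2⟩).castSucc := by
    have e : (⟨x, h1⟩ : Fin (n + 1)) = (⟨x - 1, h2⟩ : Fin n).succ := by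
      ext; simp; omega
    rw [← permSnoc_inv_succAbove σ v, Fin.succAbove_of_le_castSucc _ _ ?_, e]
    rw [Fin.le_iff_val_le_val]; simp; omega
  have hself (h1 : (v : ℕ) < n + 1) : (permSnoc σ v)⁻¹ ⟨v, h1⟩ = Fin.last n :=
    permSnoc_inv_self σ v
  have hv := v.isLt
  unfold insDes
  by_cases hx : n + 1 ≤ x
  · rw [permDes_of_le _ hx]
    split_ifs with h1 h2 h3
    · omega
    · rfl
    · simp; omega
    · rw [permDes_of_le _ (by omega)]
  rcases Nat.eq_zero_or_pos x with rfl | h0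
  · simp only [permDes_zero, Nat.zero_sub]
    split_ifs with h1 h2 h3 <;> first | rfl | omega
  rw [permDes_eq _ (by omega) h0]
  split_ifs with h1 h2 h3
  · rw [permDes_eq _ (by omega) h0, below x h1 _ (by omega), below (x - 1) (by omega) _ (by omega)]
    simp only [Fin.castSucc_lt_castSucc_iff]
  · subst h2
    rw [hself]
    simp [Fin.le_last]
  · subst h3
    rw [above _ (by omega) _ (by omega)]
    simp only [Nat.add_sub_cancel]
    rw [hself]
    simp [Fin.castSucc_lt_last]
    omega
  · rw [permDes_eq _ (by omega) (by omega), above x (by omega) _ (by omega),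
      above (x - 1) (by omega) _ (by omega)]
    simp only [Fin.castSucc_lt_castSucc_iff]

theorem qBinom_succ_succ' {q : ℝ} (hq : ∀ m, 0 < m → q ^ m ≠ 1) (x j : ℕ) :
    qBinom q (x + j + 1) (j + 1) = qBinom q (x + j) (j + 1) + q ^ x * qBinom q (x + j) j := by
  suffices h : (1 - q ^ (j + 1)) * qBinom q (x + j) (j + 1) = (1 - q ^ x) * qBinom q (x + j) j by
    rw [qBinom_succ_succ]; linear_combination -h
  rcases x with _ | x
  · rw [qBinom_eq_zero q (by omega)]; simp
  have h1 := qBinom_mul_qPoch q (j + 1) x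
  have h2 := qBinom_mul_qPoch q j (x + 1)
  rw [show j + 1 + x = x + 1 + j by ring] at h1
  rw [show j + (x + 1) = x + 1 + j by ring] at h2
  rw [qPoch_succ] at h1 h2
  have h3 : qPoch q j * qPoch q x ≠ 0 := mul_ne_zero (qPoch_ne_zero hq j) (qPoch_ne_zero hq x)
  refine mul_left_cancel₀ h3 ?_
  linear_combination h1 - h2

/-- The number of descents in `[x, l)` recorded by `D`. -/
def desFrom (l : ℕ) (D : ℕ → Bool) (x : ℕ) : ℕ := ∑ i ∈ range (l - x), if D (x + i) then 1 else 0

theorem desFrom_of_lt {l x : ℕ} (D : ℕ → Bool) (h : x < l) :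
    desFrom l D x = desFrom l D (x + 1) + if D x then 1 else 0 := by
  rw [desFrom, show l - x = (l - (x + 1)) + 1 by omega, sum_range_succ', desFrom]
  simp [add_assoc, add_comm 1]

@[simp] theorem desFrom_self (l : ℕ) (D : ℕ → Bool) : desFrom l D l = 0 := by simp [desFrom]

/-- The change of the sum of descents when a new largest letter is inserted at position `v`. -/
def insGain (l v : ℕ) (D : ℕ → Bool) : ℕ :=
  if v = l then 0 else (if D v then 1 else v + 1) + desFrom l D (v + 1)

theorem desWt_insDes {l v : ℕ} (D : ℕ → Bool) (h : v ≤ l) :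
    desWt (l + 1) (insDes l v D) = desWt l D + insGain l v D := by
  rcases h.eq_or_lt with rfl | h
  · rw [desWt, sum_range_succ, desWt, insGain]
    simp only [if_true, add_zero]
    rw [if_neg (by simp [insDes]), add_zero]
    refine sum_congr rfl fun x hx => ?_
    simp [insDes, mem_range.1 hx]
  · obtain ⟨r, rfl⟩ : ∃ r, l = v + 1 + r := ⟨l - (v + 1), by omega⟩
    rw [insGain, if_neg (by omega), desFrom, desWt, desWt,
      show v + 1 + r + 1 = v + (r + 1 + 1) by ring, sum_range_add, sum_range_succ', sum_range_succ',
      show v + 1 + r = v + (r + 1) by ring, sum_range_add, sum_range_succ']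
    have h1 : ∑ x ∈ range v, (if insDes (v + (r + 1)) v D x then x else 0)
        = ∑ x ∈ range v, if D x then x else 0 :=
      sum_congr rfl fun x hx => by simp [insDes, mem_range.1 hx]
    have h2 : ∑ k ∈ range r,
        (if insDes (v + (r + 1)) v D (v + (k + 1 + 1)) then v + (k + 1 + 1) else 0)
        = ∑ k ∈ range r, ((if D (v + (k + 1)) then v + (k + 1) else 0) +
          if D (v + 1 + k) then 1 else 0) := by
      refine sum_congr rfl fun x hx => ?_
      have : insDes (v + (r + 1)) v D (v + (x + 1 + 1)) = D (v + (x + 1)) := by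
        simp only [insDes]
        rw [if_neg (by omega), if_neg (by omega), if_neg (by omega)]
        rfl
      rw [this, show v + 1 + x = v + (x + 1) by ring]
      split_ifs <;> ring
    rw [h1, h2, sum_add_distrib]
    have h3 : insDes (v + (r + 1)) v D (v + 0) = false := by simp [insDes]
    have h4 : insDes (v + (r + 1)) v D (v + (0 + 1)) = true := by simp [insDes]
    have h5 : v + (r + 1) - (v + 1) = r := by omega
    simp only [h3, h4, h5]
    simp only [if_true, add_zero, zero_add]
    split_ifs <;> simp_all <;> omega

section increasing
variable (l : ℕ) (D₀ : ℕ → Bool)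

/-- The sum of `Ψ` over the descent records obtained from `D₀` by inserting new largest letters at
positions `v₀ < v₁ < ⋯ < v_j = v`. -/
def incSum : ℕ → ℕ → ((ℕ → Bool) → ℝ) → ℝ
  | 0, v, Ψ => Ψ (insDes l v D₀)
  | j + 1, v, Ψ => ∑ w ∈ (range (l + j + 1)).filter (· < v),
      incSum j w fun D => Ψ (insDes (l + j + 1) v D)

theorem incSum_eq_zero {j v : ℕ} (h : v < j) (Ψ : (ℕ → Bool) → ℝ) : incSum l D₀ j v Ψ = 0 := by
  induction j generalizing v Ψ with
  | zero => omega
  | succ j ih =>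
    refine sum_eq_zero fun w hw => ih ?_ _
    have := (mem_filter.1 hw).2
    omega

theorem incSum_congr {j v : ℕ} {Ψ Φ : (ℕ → Bool) → ℝ} (c : ℝ)
    (h : ∀ D : ℕ → Bool, (∀ x, v + 1 < x → D x = D₀ (x - (j + 1))) →
      D (v + 1) = decide (v < l + j) → Ψ D = c * Φ D) :
    incSum l D₀ j v Ψ = c * incSum l D₀ j v Φ := by
  induction j generalizing v Ψ Φ with
  | zero =>
    refine h _ (fun x hx => ?_) ?_
    · simp only [insDes]
      rw [if_neg (by omega), if_neg (by omega), if_neg (by omega)]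
    · simp [insDes]
  | succ j ih =>
    rw [incSum, incSum, mul_sum]
    refine sum_congr rfl fun w hw => ih fun D hD _ => h _ (fun x hx => ?_) ?_
    · have := (mem_filter.1 hw).2
      simp only [insDes]
      rw [if_neg (by omega), if_neg (by omega), if_neg (by omega), hD _ (by omega)]
      congr 1; omega
    · simp [insDes, add_assoc]

/-- The generating function of the sum of descents over `incSum`, in terms of the offset `v - j`. -/
def incGF (q : ℝ) (j x : ℕ) : ℝ := incSum l D₀ j (x + j) fun D => q ^ desWt (l + j + 1) D

theorem incGF_zero (q : ℝ) {x : ℕ} (hx : x ≤ l) :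
    incGF l D₀ q 0 x = q ^ (desWt l D₀ + insGain l x D₀) := by
  simp [incGF, incSum, desWt_insDes D₀ hx]

theorem sum_incSum (j n : ℕ) (Ψ : ℕ → (ℕ → Bool) → ℝ) :
    ∑ w ∈ range (n + j), incSum l D₀ j w (Ψ w) =
      ∑ x ∈ range n, incSum l D₀ j (x + j) (Ψ (x + j)) := by
  rw [add_comm n j, sum_range_add, sum_eq_zero fun w hw => incSum_eq_zero l D₀ (mem_range.1 hw) _,
    zero_add]
  exact sum_congr rfl fun x _ => by rw [add_comm]

theorem incSum_pow_desWt (q : ℝ) {j x w : ℕ} (hx : x ≤ l) (hw : w ≤ x) :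
    incSum l D₀ j (w + j)
        (fun D => q ^ desWt (l + j + 1 + 1) (insDes (l + j + 1) (x + (j + 1)) D)) =
      q ^ (if x = l then 0 else
        (if w = x ∨ D₀ x then 1 else x + (j + 1) + 1) + desFrom l D₀ (x + 1)) *
      incGF l D₀ q j w := by
  refine incSum_congr l D₀ _ fun D hD hD' => ?_
  rw [desWt_insDes D (by omega), pow_add, mul_comm]
  congr 2
  rw [insGain]
  by_cases hxl : x = l
  · rw [if_pos (by omega), if_pos hxl]
  rw [if_neg (by omega), if_neg hxl]
  congr 1
  · by_cases hwx : w = x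
    · subst hwx
      have : D (w + (j + 1)) = true := by
        rw [← add_assoc, hD', decide_eq_true_iff]; omega
      simp [this]
    · rw [hD _ (by omega), Nat.add_sub_cancel]
      simp [hwx]
  · rw [desFrom, desFrom, show l + j + 1 - (x + (j + 1) + 1) = l - (x + 1) by omega]
    refine sum_congr rfl fun i _ => ?_
    rw [hD _ (by omega), show x + (j + 1) + 1 + i - (j + 1) = x + 1 + i by omega]

theorem incGF_succ (q : ℝ) {j x : ℕ} (hx : x < l) :
    incGF l D₀ q (j + 1) x = q ^ (1 + desFrom l D₀ (x + 1)) * incGF l D₀ q j x +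
      q ^ ((if D₀ x then 1 else x + (j + 1) + 1) + desFrom l D₀ (x + 1)) *
        ∑ w ∈ range x, incGF l D₀ q j w := by
  have h0 : (range (l + j + 1)).filter (· < x + (j + 1)) = range (x + 1 + j) := by
    ext; simp; omega
  rw [incGF, incSum, h0, show l + (j + 1) + 1 = l + j + 1 + 1 from rfl]
  rw [sum_incSum l D₀ j (x + 1) fun _ D =>
    q ^ desWt (l + j + 1 + 1) (insDes (l + j + 1) (x + (j + 1)) D), sum_range_succ, add_comm]
  congr 1
  · rw [incSum_pow_desWt l D₀ q hx.le le_rfl, if_neg hx.ne]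
    simp
  · rw [mul_sum]
    refine sum_congr rfl fun w hw => ?_
    have := mem_range.1 hw
    rw [incSum_pow_desWt l D₀ q hx.le this.le, if_neg hx.ne]
    simp [this.ne]

theorem incGF_succ_self (q : ℝ) (j : ℕ) :
    incGF l D₀ q (j + 1) l = ∑ w ∈ range (l + 1), incGF l D₀ q j w := by
  have h0 : (range (l + j + 1)).filter (· < l + (j + 1)) = range (l + 1 + j) := by
    ext; simp; omega
  rw [incGF, incSum, h0, show l + (j + 1) + 1 = l + j + 1 + 1 from rfl]
  rw [sum_incSum l D₀ j (l + 1) fun _ D =>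
    q ^ desWt (l + j + 1 + 1) (insDes (l + j + 1) (l + (j + 1)) D)]
  refine sum_congr rfl fun w hw => ?_
  have := mem_range.1 hw
  rw [incSum_pow_desWt l D₀ q le_rfl (by omega)]
  simp

theorem sum_incGF_of_forall {q : ℝ} (hq : ∀ m, 0 < m → q ^ m ≠ 1) {j : ℕ}
    (h : ∀ x < l, incGF l D₀ q j x = q ^ (desWt l D₀ + (j + 1) * (1 + desFrom l D₀ (x + 1)) +
      if D₀ x then 0 else x) * qBinom q (x + j) j) {x : ℕ} (hx : x ≤ l) :
    ∑ w ∈ range x, incGF l D₀ q j w =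
      q ^ (desWt l D₀ + (j + 1) + (j + 1) * desFrom l D₀ x) * qBinom q (x + j) (j + 1) := by
  induction x with
  | zero => rw [qBinom_eq_zero q (by omega)]; simp
  | succ x ih =>
    rw [sum_range_succ, ih (by omega), h x (by omega), desFrom_of_lt D₀ (by omega : x < l)]
    rw [show x + 1 + j = x + j + 1 by ring]
    split_ifs
    · rw [qBinom_succ_succ]; ring
    · rw [qBinom_succ_succ' hq]; ring

theorem incGF_eq {q : ℝ} (hq : ∀ m, 0 < m → q ^ m ≠ 1) (j : ℕ) :
    (∀ x < l, incGF l D₀ q j x = q ^ (desWt l D₀ + (j + 1) * (1 + desFrom l D₀ (x + 1)) +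
      if D₀ x then 0 else x) * qBinom q (x + j) j) ∧
    incGF l D₀ q j l = q ^ desWt l D₀ * qBinom q (l + j) j := by
  induction j with
  | zero =>
    constructor
    · intro x hx
      rw [incGF_zero _ _ _ hx.le, insGain, if_neg hx.ne, qBinom_zero_right, mul_one]
      congr 1
      split_ifs <;> ring
    · rw [incGF_zero _ _ _ le_rfl, insGain, qBinom_zero_right]
      simp
  | succ j ih =>
    constructor
    · intro x hx
      rw [incGF_succ _ _ _ hx, sum_incGF_of_forall _ _ hq ih.1 hx.le, ih.1 x hx,
        desFrom_of_lt D₀ hx, ← add_assoc x, qBinom_succ_succ]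
      split_ifs <;> ring
    · rw [incGF_succ_self, sum_range_succ, sum_incGF_of_forall _ _ hq ih.1 le_rfl, ih.2,
        desFrom_self, ← add_assoc l, qBinom_succ_succ]
      ring

theorem sum_incGF {q : ℝ} (hq : ∀ m, 0 < m → q ^ m ≠ 1) (j : ℕ) :
    ∑ x ∈ range (l + 1), incGF l D₀ q j x =
    q ^ desWt l D₀ * qBinom q (l + j + 1) (j + 1) := by
  rw [← incGF_succ_self, (incGF_eq l D₀ hq (j + 1)).2, add_assoc]

end increasing

/-- Sum over permutations with an appended last letter `a.1`, weighted by the major index and by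
`a.2` of the descents of the inverse. -/
noncomputable def permSnocSum (p : ℝ) (n : ℕ) (a : ℕ × ((ℕ → Bool) → ℝ)) : ℝ :=
  ∑ σ : Equiv.Perm (Fin n), p ^ (maj σ + if a.1 ≤ lastVal σ then n else 0) *
    a.2 (insDes n a.1 (permDes σ⁻¹))

/-- As `permSnocSum`, with the major index of the permutation before the last letter is added. -/
noncomputable def permSum (p : ℝ) (n : ℕ) (a : ℕ × ((ℕ → Bool) → ℝ)) : ℝ :=
  ∑ σ : Equiv.Perm (Fin n), p ^ maj σ * a.2 (insDes n a.1 (permDes σ⁻¹))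

theorem sum_perm_succ_maj (p : ℝ) (n : ℕ) (Φ : (ℕ → Bool) → ℝ) :
    ∑ π : Equiv.Perm (Fin (n + 1)), p ^ maj π * Φ (permDes π⁻¹) =
      ∑ v ∈ range (n + 1), permSnocSum p n (v, Φ) := by
  rw [sum_perm_succ, ← Fin.sum_univ_eq_sum_range fun v => permSnocSum p n (v, Φ)]
  simp only [maj_permSnoc, permDes_permSnoc_inv, permSnocSum]

theorem permSnocSum_succ (p : ℝ) (n : ℕ) (a : ℕ × ((ℕ → Bool) → ℝ)) :
    permSnocSum p (n + 1) a = ∑ v ∈ range (n + 1), p ^ (if a.1 ≤ v then n + 1 else 0) *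
      permSnocSum p n (v, fun D => a.2 (insDes (n + 1) a.1 D)) := by
  rw [permSnocSum, sum_perm_succ, ← Fin.sum_univ_eq_sum_range fun v =>
    p ^ (if a.1 ≤ v then n + 1 else 0) *
      permSnocSum p n (v, fun D => a.2 (insDes (n + 1) a.1 D))]
  simp only [maj_permSnoc, permDes_permSnoc_inv, permSnocSum, lastVal_permSnoc, mul_sum]
  refine sum_congr rfl fun v _ => sum_congr rfl fun σ _ => ?_
  rw [pow_add p (_ + _)]
  ring

theorem permSnocSum_eq (p : ℝ) (n : ℕ) (a : ℕ × ((ℕ → Bool) → ℝ)) :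
    permSnocSum p n a = ∑ j ∈ range (n + 1), runCoeff p n j *
      ∑ σ : Equiv.Perm (Fin (n - j)), p ^ maj σ * incSum (n - j) (permDes σ⁻¹) j a.1 a.2 := by
  have run (i j : ℕ) (a : ℕ × ((ℕ → Bool) → ℝ)) :
      runSum (fun n _ => range (n + 1)) (fun n (a : ℕ × ((ℕ → Bool) → ℝ)) v =>
        (v, fun D => a.2 (insDes (n + 1) a.1 D)))
        (fun a v => a.1 ≤ v) (permSum p) i j a =
      ∑ σ : Equiv.Perm (Fin i), p ^ maj σ * incSum i (permDes σ⁻¹) j a.1 a.2 := by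
    induction j generalizing a with
    | zero => rfl
    | succ j ih =>
      simp only [runSum, ih, incSum, not_le, mul_sum]
      rw [sum_comm]
  rw [eq_sum_runCoeff_mul_runSum (fun n _ => range (n + 1))
    (fun n (a : ℕ × ((ℕ → Bool) → ℝ)) v => (v, fun D => a.2 (insDes (n + 1) a.1 D)))
    (fun a v => a.1 ≤ v)
    (q := p) (F := permSum p) (X := permSnocSum p) ?_ ?_ (permSnocSum_succ p) n a]
  · simp only [run]
  · intro n a
    exact sum_perm_succ_maj p n fun D => a.2 (insDes (n + 1) a.1 D)
  · intro a
    simp [permSnocSum, permSum]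

theorem Apq_eq (p q : ℝ) (n : ℕ) :
    Apq p q n = ∑ π : Equiv.Perm (Fin n), p ^ maj π * q ^ desWt n (permDes π⁻¹) := by
  rw [Apq, ← Equiv.sum_comp (Equiv.inv _)]
  simp [imaj, maj_eq_desWt]

theorem Apq_succ {q : ℝ} (hq : ∀ m, 0 < m → q ^ m ≠ 1) (p : ℝ) (n : ℕ) :
    Apq p q (n + 1) = ∑ j ∈ range (n + 1),
      runCoeff p n j * (qBinom q (n + 1) (j + 1) * Apq p q (n - j)) := by
  rw [Apq_eq, sum_perm_succ_maj p n fun D => q ^ desWt (n + 1) D]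
  simp only [permSnocSum_eq]
  rw [sum_comm]
  refine sum_congr rfl fun j hj => ?_
  rw [← mul_sum]
  congr 1
  have hl : n = n - j + j := by have := mem_range.1 hj; omega
  generalize n - j = l at hl ⊢
  subst hl
  rw [sum_comm, Apq_eq, mul_sum]
  refine sum_congr rfl fun σ _ => ?_
  rw [← mul_sum, show range (l + j + 1) = range (l + 1 + j) by congr 1; ring, sum_incSum]
  have := sum_incGF l (permDes σ⁻¹) hq j
  simp only [incGF] at this
  rw [this]
  ring

theorem Apq_zero (p q : ℝ) : Apq p q 0 = 1 := by
  simp [Apq, imaj, maj]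

theorem Apq_div_qPoch {p q : ℝ} (hp : ∀ m, 0 < m → p ^ m ≠ 1) (hq : ∀ m, 0 < m → q ^ m ≠ 1)
    (k : ℕ) : Apq p q k / (qPoch p k * qPoch q k) = ∑ x ∈ antidiagonal k,
      p ^ x.1 * (Apq p q x.1 / (qPoch p x.1 * qPoch q x.1)) * (qPoch q x.2)⁻¹ := by
  rcases k with _ | n
  · simp [Apq_zero]
  have hP := qPoch_ne_zero hp
  have hQ := qPoch_ne_zero hq
  have key : (1 - p ^ (n + 1)) * (Apq p q (n + 1) / (qPoch p (n + 1) * qPoch q (n + 1))) =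
      ∑ j ∈ range (n + 1), p ^ (n - j) *
        (Apq p q (n - j) / (qPoch p (n - j) * qPoch q (n - j))) * (qPoch q (j + 1))⁻¹ := by
    rw [Apq_succ hq, sum_div, mul_sum]
    refine sum_congr rfl fun j hj => ?_
    obtain ⟨l, rfl⟩ : ∃ l, n = l + j := ⟨n - j, by have := mem_range.1 hj; omega⟩
    rw [Nat.add_sub_cancel]
    have h1 := runCoeff_mul_qPoch p l j
    have h2 := qBinom_mul_qPoch q (j + 1) l
    rw [show j + 1 + l = l + j + 1 by ring] at h2
    have h3 : runCoeff p (l + j) j = p ^ l * qPoch p (l + j) / qPoch p l := by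
      rw [eq_div_iff (hP l), h1]
    have h4 : qBinom q (l + j + 1) (j + 1) =
        qPoch q (l + j + 1) / (qPoch q (j + 1) * qPoch q l) := by
      rw [eq_div_iff (mul_ne_zero (hQ _) (hQ l)), h2]
    have h5 : 1 - p ^ (l + j + 1) ≠ 0 := sub_ne_zero.2 (hp _ (by omega)).symm
    rw [h3, h4, qPoch_succ p]
    have a1 := hP l
    have a2 := hP (l + j)
    have a3 := hQ l
    have a4 := hQ (j + 1)
    have a5 := hQ (l + j + 1)
    field_simp
  rw [Nat.sum_antidiagonal_eq_sum_range_succ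
    (fun i j => p ^ i * (Apq p q i / (qPoch p i * qPoch q i)) * (qPoch q j)⁻¹), sum_range_succ,
    ← sum_range_reflect]
  simp only [Nat.sub_self, qPoch_zero]
  have : ∑ j ∈ range (n + 1), p ^ (n + 1 - 1 - j) *
        (Apq p q (n + 1 - 1 - j) / (qPoch p (n + 1 - 1 - j) * qPoch q (n + 1 - 1 - j))) *
          (qPoch q (n + 1 - (n + 1 - 1 - j)))⁻¹ = ∑ j ∈ range (n + 1), p ^ (n - j) *
        (Apq p q (n - j) / (qPoch p (n - j) * qPoch q (n - j))) * (qPoch q (j + 1))⁻¹ := by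
    refine sum_congr rfl fun j hj => ?_
    have := mem_range.1 hj
    rw [show n + 1 - (n + 1 - 1 - j) = j + 1 by omega, Nat.add_sub_cancel]
  rw [this, ← key]
  ring

theorem le_iff_rowLen {μ ν : YoungDiagram} : μ ≤ ν ↔ ∀ i, μ.rowLen i ≤ ν.rowLen i := by
  constructor
  · intro h i
    by_contra! hlt
    have : (i, ν.rowLen i) ∈ ν := h (YoungDiagram.mem_iff_lt_rowLen.2 hlt)
    exact (YoungDiagram.mem_iff_lt_rowLen.1 this).false
  · rintro h ⟨i, j⟩ hij
    exact YoungDiagram.mem_iff_lt_rowLen.2 ((YoungDiagram.mem_iff_lt_rowLen.1 hij).trans_le (h i))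

theorem ext_rowLen {μ ν : YoungDiagram} (h : ∀ i, μ.rowLen i = ν.rowLen i) : μ = ν :=
  le_antisymm (le_iff_rowLen.2 fun i => (h i).le) (le_iff_rowLen.2 fun i => (h i).ge)

theorem rowLen_succ_le (μ : YoungDiagram) (i : ℕ) : μ.rowLen (i + 1) ≤ μ.rowLen i :=
  μ.rowLen_anti _ _ i.le_succ

theorem rowLen_colLen (μ : YoungDiagram) : μ.rowLen (μ.colLen 0) = 0 := by
  by_contra h
  have := YoungDiagram.mem_iff_lt_rowLen.2 (Nat.pos_of_ne_zero h)
  exact (YoungDiagram.mem_iff_lt_colLen.1 this).false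

theorem card_eq_sum_rowLen {μ : YoungDiagram} {N : ℕ} (h : μ.rowLen N = 0) :
    μ.card = ∑ i ∈ range N, μ.rowLen i := by
  rw [YoungDiagram.card, card_eq_sum_card_fiberwise (f := Prod.fst) (t := range N)]
  · exact sum_congr rfl fun i _ => μ.rowLen_eq_card.symm
  · rintro ⟨i, j⟩ hij
    have hij' : (i, j) ∈ μ := hij
    have h1 := YoungDiagram.mem_iff_lt_rowLen.1 hij'
    simp only [coe_range, Set.mem_Iio]
    by_contra! hlt
    have := μ.rowLen_anti _ _ hlt
    omega

/-- The Young diagram with row lengths `f`. -/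
def ofRowFun (f : ℕ → ℕ) (hf : ∀ i, f (i + 1) ≤ f i) (N : ℕ) : YoungDiagram where
  cells := (range N ×ˢ range (f 0)).filter fun x => x.2 < f x.1
  isLowerSet := by
    rintro ⟨a, b⟩ ⟨c, d⟩ ⟨hca, hdb⟩ h
    have hf' : Antitone f := antitone_nat_of_succ_le hf
    simp only [coe_filter, mem_product, mem_range, Set.mem_ofPred_eq] at h hca hdb ⊢
    have h1 := hf' hca
    have h2 := hf' c.zero_le
    omega

theorem rowLen_ofRowFun {f : ℕ → ℕ} (hf : ∀ i, f (i + 1) ≤ f i) {N : ℕ} (hN : f N = 0) (i : ℕ) :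
    (ofRowFun f hf N).rowLen i = f i := by
  have hf' : Antitone f := antitone_nat_of_succ_le hf
  have key (j : ℕ) : j < (ofRowFun f hf N).rowLen i ↔ j < f i := by
    rw [← YoungDiagram.mem_iff_lt_rowLen, ← YoungDiagram.mem_cells]
    simp only [ofRowFun, mem_filter, mem_product, mem_range, and_iff_right_iff_imp]
    intro h
    refine ⟨?_, h.trans_le (hf' i.zero_le)⟩
    by_contra! hlt
    have := hf' hlt
    omega
  exact le_antisymm (le_of_not_gt fun h => ((key _).1 h).false)
    (le_of_not_gt fun h => ((key _).2 h).false)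

theorem mem_subDiagrams {d l : YoungDiagram} : d ∈ subDiagrams l ↔ d ≤ l := by
  simp only [subDiagrams, mem_image, mem_attach, true_and, Subtype.exists, mem_filter, mem_powerset]
  constructor
  · rintro ⟨s, ⟨hs, _⟩, rfl⟩
    exact YoungDiagram.cells_subset_iff.1 hs
  · intro h
    exact ⟨d.cells, ⟨YoungDiagram.cells_subset_iff.2 h, d.isLowerSet⟩, rfl⟩

theorem mem_diagramsOfCard {d : YoungDiagram} {k : ℕ} : d ∈ diagramsOfCard k ↔ d.card = k := by
  rw [diagramsOfCard, mem_filter, mem_subDiagrams, and_iff_right_iff_imp]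
  rintro rfl ⟨i, j⟩ hij
  have h1 : d.rowLen i ≤ d.card := by
    rw [YoungDiagram.rowLen_eq_card]
    exact card_le_card (filter_subset _ _)
  have h2 : d.colLen j ≤ d.card := by
    rw [YoungDiagram.colLen_eq_card]
    exact card_le_card (filter_subset _ _)
  have h3 := YoungDiagram.mem_iff_lt_rowLen.1 hij
  have h4 := YoungDiagram.mem_iff_lt_colLen.1 hij
  have : (i, j) ∈ (square d.card).cells := by
    simp only [square, mem_product, mem_range]
    omega
  exact this

/-- The diagrams obtained from `l` by removing one cell. -/
noncomputable def lowerCovers (l : YoungDiagram) : Finset YoungDiagram :=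
  (subDiagrams l).filter fun ν => ν.card + 1 = l.card

theorem mem_lowerCovers {ν l : YoungDiagram} : ν ∈ lowerCovers l ↔ ν ≤ l ∧ ν.card + 1 = l.card := by
  rw [lowerCovers, mem_filter, mem_subDiagrams]

/-- The row of the unique cell of `l / ν`. -/
def newRow (ν l : YoungDiagram) : ℕ := (l.cells \ ν.cells).sup Prod.fst

theorem rowLen_eq_of_mem_lowerCovers {ν l : YoungDiagram} (h : ν ∈ lowerCovers l) (i : ℕ) :
    l.rowLen i = ν.rowLen i + if i = newRow ν l then 1 else 0 := by
  rw [mem_lowerCovers] at h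
  have hsub := YoungDiagram.cells_subset_iff.2 h.1
  have h1 : (l.cells \ ν.cells).card = 1 := by
    have h2 := h.2
    simp only [YoungDiagram.card] at h2
    rw [card_sdiff_of_subset hsub]; omega
  obtain ⟨⟨r, c⟩, hrc⟩ := card_eq_one.1 h1
  have hr : newRow ν l = r := by simp [newRow, hrc]
  have hl : l.row i = ν.row i ∪ (l.cells \ ν.cells).filter (·.1 = i) := by
    ext x
    have : x ∈ ν.cells → x ∈ l.cells := fun hx => hsub hx
    simp only [YoungDiagram.row, mem_filter, mem_union, mem_sdiff]
    tauto
  rw [l.rowLen_eq_card, ν.rowLen_eq_card, hl, card_union_of_disjoint, hrc, hr]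
  · congr 1
    split_ifs with hi
    · simp [hi, filter_singleton]
    · simp [filter_singleton, Ne.symm hi]
  · rw [disjoint_left]
    intro x hx hx'
    exact (mem_sdiff.1 (mem_filter.1 hx').1).2 (mem_filter.1 hx).1

theorem exists_rowLen_eq_zero (μ ν : YoungDiagram) : ∃ N, μ.rowLen N = 0 ∧ ν.rowLen N = 0 := by
  refine ⟨max (μ.colLen 0) (ν.colLen 0), ?_, ?_⟩
  · have := μ.rowLen_anti _ _ (le_max_left (μ.colLen 0) (ν.colLen 0))
    rw [rowLen_colLen] at this; omega
  · have := ν.rowLen_anti _ _ (le_max_right (μ.colLen 0) (ν.colLen 0))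
    rw [rowLen_colLen] at this; omega

theorem card_eq_of_rowLen_eq {ν l : YoungDiagram} {r : ℕ}
    (h : ∀ i, l.rowLen i = ν.rowLen i + if i = r then 1 else 0) : l.card = ν.card + 1 := by
  obtain ⟨N, h1, h2⟩ := exists_rowLen_eq_zero ν l
  rw [card_eq_sum_rowLen h1, card_eq_sum_rowLen h2]
  simp only [h, sum_add_distrib, sum_ite_eq']
  have := h N
  rw [if_pos]
  rw [mem_range]
  by_contra! hlt
  have h3 := h r
  have h4 := l.rowLen_anti _ _ hlt
  rw [if_pos rfl] at h3
  omega

theorem mem_lowerCovers_and_newRow {ν l : YoungDiagram} {r : ℕ} :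
    ν ∈ lowerCovers l ∧ newRow ν l = r ↔
      ∀ i, l.rowLen i = ν.rowLen i + if i = r then 1 else 0 := by
  constructor
  · rintro ⟨h, rfl⟩
    exact rowLen_eq_of_mem_lowerCovers h
  · intro h
    have hm : ν ∈ lowerCovers l :=
      mem_lowerCovers.2 ⟨le_iff_rowLen.2 fun i => by rw [h i]; omega, (card_eq_of_rowLen_eq h).symm⟩
    refine ⟨hm, ?_⟩
    have h1 := rowLen_eq_of_mem_lowerCovers hm r
    rw [h r, if_pos rfl] at h1
    by_contra hne
    rw [if_neg (Ne.symm hne)] at h1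
    omega

theorem card_le_card_of_le {μ ν : YoungDiagram} (h : μ ≤ ν) : μ.card ≤ ν.card :=
  card_le_card (YoungDiagram.cells_subset_iff.2 h)

/-- `l / ν` is a horizontal strip with `j` cells. -/
def IsHStrip (ν l : YoungDiagram) (j : ℕ) : Prop :=
  ν ≤ l ∧ (∀ i, l.rowLen (i + 1) ≤ ν.rowLen i) ∧ ν.card + j = l.card

open scoped Classical in
/-- The diagrams obtained from `l` by removing a horizontal strip with `j` cells. -/
noncomputable def hLower (l : YoungDiagram) (j : ℕ) : Finset YoungDiagram :=
  (subDiagrams l).filter fun ν => IsHStrip ν l j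

theorem mem_hLower {ν l : YoungDiagram} {j : ℕ} : ν ∈ hLower l j ↔ IsHStrip ν l j := by
  simp only [hLower, mem_filter, mem_subDiagrams, and_iff_right_iff_imp]
  exact fun h => h.1

theorem eq_of_le_of_card_eq {ν l : YoungDiagram} (h : ν ≤ l) (hc : ν.card = l.card) : ν = l := by
  refine le_antisymm h (YoungDiagram.cells_subset_iff.1 ?_)
  exact (eq_of_subset_of_card_le (YoungDiagram.cells_subset_iff.2 h) hc.ge).ge

theorem hLower_zero (l : YoungDiagram) : hLower l 0 = {l} := by
  ext ν
  rw [mem_hLower, mem_singleton]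
  constructor
  · rintro ⟨h, _, hc⟩
    exact eq_of_le_of_card_eq h hc
  · rintro rfl
    exact ⟨le_rfl, rowLen_succ_le _, rfl⟩

/-- The top row of `l / κ` is the row `r`. -/
def IsTopRow (κ l : YoungDiagram) (r : ℕ) : Prop :=
  (∀ i < r, κ.rowLen i = l.rowLen i) ∧ κ.rowLen r < l.rowLen r

theorem IsTopRow.unique {κ l : YoungDiagram} {r s : ℕ} (h : IsTopRow κ l r) (h' : IsTopRow κ l s) :
    r = s := by
  by_contra hne
  rcases Nat.lt_or_gt_of_ne hne with hlt | hlt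
  · exact h.2.ne (h'.1 r hlt)
  · exact h'.2.ne (h.1 s hlt)

theorem exists_isTopRow {κ l : YoungDiagram} (h : κ ≤ l) (hc : κ.card < l.card) :
    ∃ r, IsTopRow κ l r := by
  have hex : ∃ r, κ.rowLen r < l.rowLen r := by
    by_contra! hle
    have := le_antisymm h (le_iff_rowLen.2 hle)
    simp [this] at hc
  classical
  refine ⟨Nat.find hex, fun i hi => ?_, Nat.find_spec hex⟩
  exact le_antisymm (le_iff_rowLen.1 h i) (not_lt.1 (Nat.find_min hex hi))

theorem exists_mem_lowerCovers {κ l : YoungDiagram} {j r : ℕ} (h : IsHStrip κ l j)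
    (hr : IsTopRow κ l r) : ∃ ν ∈ lowerCovers l, newRow ν l = r := by
  have hlt := hr.2
  have hf : ∀ i, l.rowLen (i + 1) - (if i + 1 = r then 1 else 0) ≤
      l.rowLen i - if i = r then 1 else 0 := by
    intro i
    have h1 := rowLen_succ_le l i
    split_ifs with ha hb hb
    · omega
    · omega
    · subst hb
      have := h.2.1 i
      omega
    · omega
  refine ⟨ofRowFun (fun i => l.rowLen i - if i = r then 1 else 0) hf (l.colLen 0),
    mem_lowerCovers_and_newRow.2 fun i => ?_⟩
  rw [rowLen_ofRowFun (f := fun i => l.rowLen i - if i = r then 1 else 0) hf]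
  · split_ifs with hi
    · subst hi; omega
    · omega
  · rw [rowLen_colLen]; simp

theorem newRow_injOn {ν ν' l : YoungDiagram} (h : ν ∈ lowerCovers l) (h' : ν' ∈ lowerCovers l)
    (hr : newRow ν l = newRow ν' l) : ν = ν' := by
  refine ext_rowLen fun i => ?_
  have h1 := rowLen_eq_of_mem_lowerCovers h i
  have h2 := rowLen_eq_of_mem_lowerCovers h' i
  rw [hr] at h1
  omega

open scoped Classical in
theorem sum_lowerCovers_sum_hLower (l : YoungDiagram) (j r : ℕ) (g : YoungDiagram → ℝ) :
    ∑ ν ∈ (lowerCovers l).filter (fun ν => r ≤ newRow ν l),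
      ∑ κ ∈ (hLower l (j + 1)).filter (fun κ => IsTopRow κ l (newRow ν l)), g κ =
    ∑ κ ∈ (hLower l (j + 1)).filter (fun κ => ∀ i < r, κ.rowLen i = l.rowLen i), g κ := by
  rw [sum_sigma']
  refine sum_bij (fun x _ => x.2) ?_ ?_ ?_ (fun _ _ => rfl)
  · rintro ⟨ν, κ⟩ h
    simp only [mem_sigma, mem_filter] at h ⊢
    exact ⟨h.2.1, fun i hi => h.2.2.1 i (hi.trans_le h.1.2)⟩
  · rintro ⟨ν, κ⟩ h ⟨ν', κ'⟩ h' heq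
    simp only [mem_sigma, mem_filter] at h h' heq
    subst heq
    have := newRow_injOn h.1.1 h'.1.1 (h.2.2.unique h'.2.2)
    rw [this]
  · intro κ h
    rw [mem_filter, mem_hLower] at h
    obtain ⟨s, hs⟩ := exists_isTopRow h.1.1 (by have := h.1.2.2; omega)
    obtain ⟨ν, hν, rfl⟩ := exists_mem_lowerCovers h.1 hs
    refine ⟨⟨ν, κ⟩, ?_, rfl⟩
    simp only [mem_sigma, mem_filter, mem_hLower]
    refine ⟨⟨hν, ?_⟩, h.1, hs⟩
    by_contra! hlt
    exact hs.2.ne (h.2 _ hlt)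

theorem isHStrip_of_mem_lowerCovers {κ ν l : YoungDiagram} {j : ℕ} (h : ν ∈ lowerCovers l) :
    (IsHStrip κ ν j ∧ ∀ i < newRow ν l, κ.rowLen i = ν.rowLen i) ↔
      IsHStrip κ l (j + 1) ∧ IsTopRow κ l (newRow ν l) := by
  have hrow := rowLen_eq_of_mem_lowerCovers h
  have hcard := (mem_lowerCovers.1 h).2
  set r := newRow ν l
  constructor
  · rintro ⟨⟨h1, h2, h3⟩, h4⟩
    refine ⟨⟨h1.trans (mem_lowerCovers.1 h).1, fun i => ?_, by omega⟩, fun i hi => ?_, ?_⟩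
    · by_cases hi : i + 1 = r
      · have a1 := h4 i (by omega)
        have a2 := hrow i
        have a3 := rowLen_succ_le l i
        rw [if_neg (by omega)] at a2
        omega
      · have a1 := hrow (i + 1)
        have a2 := h2 i
        rw [if_neg hi] at a1
        omega
    · rw [h4 i hi, hrow i, if_neg hi.ne]; rfl
    · have := le_iff_rowLen.1 h1 r
      rw [hrow r, if_pos rfl]; omega
  · rintro ⟨⟨h1, h2, h3⟩, h4, h5⟩
    refine ⟨⟨le_iff_rowLen.2 fun i => ?_, fun i => ?_, by omega⟩, fun i hi => ?_⟩
    · have a1 := hrow i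
      have a2 := le_iff_rowLen.1 h1 i
      split_ifs at a1 with hi
      · subst hi; omega
      · omega
    · have a1 := hrow (i + 1)
      have a2 := h2 i
      omega
    · rw [h4 i hi, hrow i, if_neg hi.ne]; rfl

open scoped Classical in
theorem runSum_lowerCovers (F : YoungDiagram → ℕ → ℝ) (i j : ℕ) {ν l : YoungDiagram}
    (h : ν ∈ lowerCovers l) :
    runSum (fun _ (a : YoungDiagram × YoungDiagram) => lowerCovers a.1) (fun _ a κ => (κ, a.1))
        (fun a κ => newRow κ a.1 < newRow a.1 a.2) (fun n a => F a.1 n) i j (ν, l) =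
      ∑ κ ∈ (hLower l (j + 1)).filter (fun κ => IsTopRow κ l (newRow ν l)), F κ i := by
  induction j generalizing ν l with
  | zero =>
    have : (hLower l (0 + 1)).filter (fun κ => IsTopRow κ l (newRow ν l)) = {ν} := by
      ext κ
      rw [mem_filter, mem_hLower, ← isHStrip_of_mem_lowerCovers h, mem_singleton, ← mem_hLower,
        hLower_zero, mem_singleton]
      exact ⟨fun h => h.1, by rintro rfl; exact ⟨rfl, fun _ _ => rfl⟩⟩
    rw [this, sum_singleton, runSum]
  | succ j ih =>
    rw [runSum]
    simp only [not_lt]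
    rw [sum_congr rfl fun κ hκ => ih (mem_filter.1 hκ).1, sum_lowerCovers_sum_hLower]
    refine sum_congr ?_ fun _ _ => rfl
    ext κ
    rw [mem_filter, mem_filter, mem_hLower, mem_hLower, isHStrip_of_mem_lowerCovers h]

theorem IsSYTChain.le_last {n : ℕ} {c : Fin (n + 1) → YoungDiagram} (h : IsSYTChain c)
    (i : Fin (n + 1)) : c i ≤ c (Fin.last n) := by
  have hm : Monotone c := Fin.monotone_iff_le_succ.2 fun i => (h i i.isLt).1
  exact hm (Fin.le_last i)

theorem mem_skewSYT {mu l : YoungDiagram} {n : ℕ} {c : Fin (n + 1) → YoungDiagram} :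
    c ∈ skewSYT mu l n ↔ c 0 = mu ∧ c (Fin.last n) = l ∧ IsSYTChain c := by
  simp only [skewSYT, mem_filter, Fintype.mem_piFinset, mem_subDiagrams, and_iff_right_iff_imp]
  rintro ⟨_, rfl, h⟩
  exact h.le_last

theorem isSYTChain_snoc {n : ℕ} {c : Fin (n + 1) → YoungDiagram} {l : YoungDiagram} :
    IsSYTChain (Fin.snoc (α := fun _ => YoungDiagram) c l) ↔
      IsSYTChain c ∧ c (Fin.last n) ∈ lowerCovers l := by
  have hc (i : ℕ) (hi : i < n + 1) (hi' : i < n + 1 + 1) :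
      (Fin.snoc (α := fun _ => YoungDiagram) c l : Fin (n + 1 + 1) → YoungDiagram) ⟨i, hi'⟩ =
        c ⟨i, hi⟩ := Fin.snoc_castSucc (α := fun _ => YoungDiagram) l c ⟨i, hi⟩
  have hl : (Fin.snoc (α := fun _ => YoungDiagram) c l : Fin (n + 1 + 1) → YoungDiagram)
      ⟨n + 1, by omega⟩ = l := Fin.snoc_last (α := fun _ => YoungDiagram) l c
  rw [mem_lowerCovers]
  constructor
  · intro h
    refine ⟨fun i hi => ?_, ?_⟩
    · have := h i (by omega)
      rwa [hc i (by omega), hc (i + 1) (by omega)] at this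
    · have := h n (by omega)
      rw [hc n (by omega), hl] at this
      exact ⟨this.1, this.2.symm⟩
  · rintro ⟨h, h1, h2⟩ i hi
    rcases Nat.lt_succ_iff_lt_or_eq.1 hi with hi' | rfl
    · rw [hc i (by omega), hc (i + 1) (by omega)]
      exact h i hi'
    · rw [hc i (by omega), hl]
      exact ⟨h1, h2.symm⟩

theorem sum_skewSYT_succ (mu l : YoungDiagram) (n : ℕ)
    (Φ : (Fin (n + 1 + 1) → YoungDiagram) → ℝ) :
    ∑ c ∈ skewSYT mu l (n + 1), Φ c =
      ∑ κ ∈ lowerCovers l, ∑ c ∈ skewSYT mu κ n, Φ (Fin.snoc (α := fun _ => YoungDiagram) c l) := by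
  rw [sum_sigma']
  symm
  refine sum_bij (fun x _ => Fin.snoc (α := fun _ => YoungDiagram) x.2 l) ?_ ?_ ?_ (fun _ _ => rfl)
  · rintro ⟨κ, c⟩ h
    simp only [mem_sigma, mem_skewSYT] at h ⊢
    obtain ⟨h1, h2, h3, h4⟩ := h
    refine ⟨?_, Fin.snoc_last (α := fun _ => YoungDiagram) l c, isSYTChain_snoc.2 ⟨h4, h3 ▸ h1⟩⟩
    rw [← h2, ← Fin.castSucc_zero]
    exact Fin.snoc_castSucc (α := fun _ => YoungDiagram) l c 0
  · rintro ⟨κ, c⟩ h ⟨κ', c'⟩ h' heq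
    simp only [mem_sigma, mem_skewSYT] at h h' heq
    have hc : c = c' := by
      have := congrArg (Fin.init (α := fun _ => YoungDiagram)) heq
      simpa [Fin.init_snoc] using this
    subst hc
    have : κ = κ' := h.2.2.1.symm.trans h'.2.2.1
    subst this
    rfl
  · intro c h
    rw [mem_skewSYT] at h
    obtain ⟨h1, h2, h3⟩ := h
    have hs : Fin.snoc (α := fun _ => YoungDiagram) (Fin.init c) l = c := by
      rw [← h2]; exact Fin.snoc_init_self c
    rw [← hs, isSYTChain_snoc] at h3
    refine ⟨⟨Fin.init (α := fun _ => YoungDiagram) c (Fin.last n), Fin.init c⟩, ?_, hs⟩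
    simp only [mem_sigma, mem_skewSYT]
    exact ⟨h3.2, h1, trivial, h3.1⟩

theorem rowOfStep_snoc_of_lt {n i : ℕ} (c : Fin (n + 1) → YoungDiagram) (l : YoungDiagram)
    (h : i < n) : rowOfStep (Fin.snoc (α := fun _ => YoungDiagram) c l) i = rowOfStep c i := by
  have hc (i : ℕ) (hi : i < n + 1) (hi' : i < n + 1 + 1) :
      (Fin.snoc (α := fun _ => YoungDiagram) c l : Fin (n + 1 + 1) → YoungDiagram) ⟨i, hi'⟩ =
        c ⟨i, hi⟩ := Fin.snoc_castSucc (α := fun _ => YoungDiagram) l c ⟨i, hi⟩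
  rw [rowOfStep, rowOfStep, dif_pos (by omega), dif_pos h, hc i (by omega), hc (i + 1) (by omega)]

theorem rowOfStep_snoc_self {n : ℕ} (c : Fin (n + 1) → YoungDiagram) (l : YoungDiagram) :
    rowOfStep (Fin.snoc (α := fun _ => YoungDiagram) c l) n = newRow (c (Fin.last n)) l := by
  have hc : (Fin.snoc (α := fun _ => YoungDiagram) c l : Fin (n + 1 + 1) → YoungDiagram)
      ⟨n, by omega⟩ = c (Fin.last n) :=
    Fin.snoc_castSucc (α := fun _ => YoungDiagram) l c (Fin.last n)
  have hl : (Fin.snoc (α := fun _ => YoungDiagram) c l : Fin (n + 1 + 1) → YoungDiagram)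
      ⟨n + 1, by omega⟩ = l := Fin.snoc_last (α := fun _ => YoungDiagram) l c
  rw [rowOfStep, dif_pos (by omega), hc, hl, newRow]

theorem chainMaj_snoc_snoc {n : ℕ} (c : Fin (n + 1) → YoungDiagram) (ν l : YoungDiagram) :
    chainMaj (Fin.snoc (α := fun _ => YoungDiagram) (Fin.snoc (α := fun _ => YoungDiagram) c ν) l) =
      chainMaj (Fin.snoc (α := fun _ => YoungDiagram) c ν) +
        if newRow (c (Fin.last n)) ν < newRow ν l then n + 1 else 0 := by
  have hl : (Fin.snoc (α := fun _ => YoungDiagram) c ν : Fin (n + 1 + 1) → YoungDiagram)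
      (Fin.last (n + 1)) = ν := Fin.snoc_last (α := fun _ => YoungDiagram) ν c
  rw [chainMaj, sum_range_succ, sum_range_succ, chainMaj, sum_range_succ]
  rw [rowOfStep_snoc_self, rowOfStep_snoc_of_lt _ _ (Nat.lt_succ_self n), rowOfStep_snoc_self, hl]
  simp only [lt_self_iff_false, false_and, if_false, add_zero, Nat.lt_succ_self, true_and]
  congr 1
  refine sum_congr rfl fun i hi => ?_
  have := mem_range.1 hi
  rw [rowOfStep_snoc_of_lt (i := i) _ l (by omega),
    rowOfStep_snoc_of_lt (i := i + 1) _ l (by omega)]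
  have h1 : i + 1 < n + 1 + 1 := by omega
  have h2 : i + 1 < n + 1 := by omega
  simp only [h1, h2]

open scoped Classical in
theorem fSkew_succ (mu l : YoungDiagram) (n : ℕ) (q : ℝ) :
    fSkew mu l (n + 1) q = ∑ j ∈ range (n + 1), runCoeff q n j *
      ∑ κ ∈ hLower l (j + 1), fSkew mu κ (n - j) q := by
  let X (n : ℕ) (a : YoungDiagram × YoungDiagram) : ℝ :=
    ∑ c ∈ skewSYT mu a.1 n, q ^ chainMaj (Fin.snoc (α := fun _ => YoungDiagram) c a.2)
  have hX0 (a : YoungDiagram × YoungDiagram) : X 0 a = fSkew mu a.1 0 q := by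
    simp [X, fSkew, chainMaj]
  have hX (n : ℕ) (a : YoungDiagram × YoungDiagram) : X (n + 1) a =
      ∑ κ ∈ lowerCovers a.1, q ^ (if newRow κ a.1 < newRow a.1 a.2 then n + 1 else 0) *
        X n (κ, a.1) := by
    simp only [X, sum_skewSYT_succ, mul_sum]
    refine sum_congr rfl fun κ _ => sum_congr rfl fun c hc => ?_
    rw [chainMaj_snoc_snoc, (mem_skewSYT.1 hc).2.1, pow_add, mul_comm]
  have hF (n : ℕ) (a : YoungDiagram × YoungDiagram) : fSkew mu a.1 (n + 1) q =
      ∑ κ ∈ lowerCovers a.1, X n (κ, a.1) := sum_skewSYT_succ _ _ _ _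
  have key := eq_sum_runCoeff_mul_runSum
    (fun _ (a : YoungDiagram × YoungDiagram) => lowerCovers a.1) (fun _ a κ => (κ, a.1))
    (fun a κ => newRow κ a.1 < newRow a.1 a.2) (F := fun n a => fSkew mu a.1 n q) hF hX0 hX n
  have hl := sum_skewSYT_succ mu l n fun c => q ^ chainMaj c
  rw [fSkew, hl]
  have h2 : ∀ ν ∈ lowerCovers l,
      ∑ c ∈ skewSYT mu ν n, q ^ chainMaj (Fin.snoc (α := fun _ => YoungDiagram) c l) =
      ∑ j ∈ range (n + 1), runCoeff q n j *
        ∑ κ ∈ (hLower l (j + 1)).filter (fun κ => IsTopRow κ l (newRow ν l)),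
          fSkew mu κ (n - j) q := by
    intro ν hν
    refine (key (ν, l)).trans (sum_congr rfl fun j _ => ?_)
    rw [runSum_lowerCovers (fun κ i => fSkew mu κ i q) (n - j) j hν]
  rw [sum_congr rfl h2, sum_comm]
  refine sum_congr rfl fun j _ => ?_
  rw [← mul_sum]
  congr 1
  have := sum_lowerCovers_sum_hLower l j 0 fun κ => fSkew mu κ (n - j) q
  simpa using this

open scoped Classical in
/-- The Young diagram with row lengths `f` (`⊥` if there is none). -/
noncomputable def toDiagram (f : ℕ → ℕ) : YoungDiagram :=
  if h : ∃ μ : YoungDiagram, ∀ i, μ.rowLen i = f i then h.choose else ⊥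

theorem rowLen_toDiagram {f : ℕ → ℕ} (hf : ∀ i, f (i + 1) ≤ f i) {N : ℕ} (hN : f N = 0) (i : ℕ) :
    (toDiagram f).rowLen i = f i := by
  have h : ∃ μ : YoungDiagram, ∀ i, μ.rowLen i = f i :=
    ⟨ofRowFun f hf N, rowLen_ofRowFun hf hN⟩
  rw [toDiagram, dif_pos h]
  exact h.choose_spec i

theorem rowLen_eq_zero_of_le {μ : YoungDiagram} {M N : ℕ} (h : μ.rowLen M = 0) (hMN : M ≤ N) :
    μ.rowLen N = 0 := by
  have := μ.rowLen_anti _ _ hMN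
  omega

open scoped Classical in
/-- The diagrams obtained from `ν` by adding a horizontal strip with `j` cells. -/
noncomputable def hUpper (ν : YoungDiagram) (j : ℕ) : Finset YoungDiagram :=
  (diagramsOfCard (ν.card + j)).filter fun l => IsHStrip ν l j

theorem mem_hUpper {ν l : YoungDiagram} {j : ℕ} : l ∈ hUpper ν j ↔ IsHStrip ν l j := by
  simp only [hUpper, mem_filter, mem_diagramsOfCard, and_iff_right_iff_imp]
  exact fun h => h.2.2.symm

section exchange
variable {α β μ l : YoungDiagram} {i j k : ℕ}

theorem card_add_card_eq (h0 : l.rowLen 0 = k + max (α.rowLen 0) (β.rowLen 0))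
    (h : ∀ t, μ.rowLen t + l.rowLen (t + 1) =
      min (α.rowLen t) (β.rowLen t) + max (α.rowLen (t + 1)) (β.rowLen (t + 1))) :
    μ.card + l.card = k + α.card + β.card := by
  obtain ⟨N, hα, hβ⟩ := exists_rowLen_eq_zero α β
  have hα' := rowLen_eq_zero_of_le hα N.le_succ
  have hβ' := rowLen_eq_zero_of_le hβ N.le_succ
  have hN := h N
  simp only [hα, hβ, hα', hβ'] at hN
  rw [card_eq_sum_rowLen hα, card_eq_sum_rowLen hβ,
    card_eq_sum_rowLen (μ := μ) (N := N) (by omega),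
    card_eq_sum_rowLen (μ := l) (N := N + 1) (by omega), sum_range_succ', h0]
  have e1 : ∑ t ∈ range N, max (α.rowLen (t + 1)) (β.rowLen (t + 1)) + max (α.rowLen 0) (β.rowLen 0)
      = ∑ t ∈ range N, max (α.rowLen t) (β.rowLen t) := by
    rw [← sum_range_succ' (fun t => max (α.rowLen t) (β.rowLen t)), sum_range_succ, hα, hβ]
    simp
  have e2 : ∑ t ∈ range N, μ.rowLen t + ∑ t ∈ range N, l.rowLen (t + 1) =
      ∑ t ∈ range N, min (α.rowLen t) (β.rowLen t) +
        ∑ t ∈ range N, max (α.rowLen (t + 1)) (β.rowLen (t + 1)) := by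
    rw [← sum_add_distrib, ← sum_add_distrib]
    exact sum_congr rfl fun t _ => h t
  have e3 : ∑ t ∈ range N, min (α.rowLen t) (β.rowLen t) +
      ∑ t ∈ range N, max (α.rowLen t) (β.rowLen t) =
      ∑ t ∈ range N, α.rowLen t + ∑ t ∈ range N, β.rowLen t := by
    rw [← sum_add_distrib, ← sum_add_distrib]
    exact sum_congr rfl fun t _ => min_add_max _ _
  omega

/-- The diagram below `α` and `β` corresponding to a diagram `l` above them. -/
noncomputable def exchangeDown (α β l : YoungDiagram) : YoungDiagram :=
  toDiagram fun t => min (α.rowLen t) (β.rowLen t) + max (α.rowLen (t + 1)) (β.rowLen (t + 1)) -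
    l.rowLen (t + 1)

/-- The diagram above `α` and `β` corresponding to a diagram `μ` below them. -/
noncomputable def exchangeUp (α β μ : YoungDiagram) (k : ℕ) : YoungDiagram :=
  toDiagram fun t => t.casesOn (k + max (α.rowLen 0) (β.rowLen 0)) fun t =>
    min (α.rowLen t) (β.rowLen t) + max (α.rowLen (t + 1)) (β.rowLen (t + 1)) - μ.rowLen t

theorem rowLen_exchangeDown (hα : IsHStrip α l i) (hβ : IsHStrip β l j) (t : ℕ) :
    (exchangeDown α β l).rowLen t + l.rowLen (t + 1) =
      min (α.rowLen t) (β.rowLen t) + max (α.rowLen (t + 1)) (β.rowLen (t + 1)) := by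
  obtain ⟨N, h1, h2⟩ := exists_rowLen_eq_zero α β
  have h1' := rowLen_eq_zero_of_le h1 N.le_succ
  have h2' := rowLen_eq_zero_of_le h2 N.le_succ
  rw [exchangeDown, rowLen_toDiagram (N := N)]
  · have := hα.2.1 t
    have := hβ.2.1 t
    omega
  · intro t
    have a1 := hα.2.1 t
    have a2 := hβ.2.1 t
    have a3 := le_iff_rowLen.1 hα.1 (t + 1)
    have a4 := le_iff_rowLen.1 hβ.1 (t + 1)
    have a5 := hα.2.1 (t + 1)
    have a6 := hβ.2.1 (t + 1)
    have a7 := le_iff_rowLen.1 hα.1 (t + 1 + 1)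
    have a8 := le_iff_rowLen.1 hβ.1 (t + 1 + 1)
    omega
  · simp only [h1, h2, Nat.succ_eq_add_one] at h1' h2' ⊢
    rw [h1', h2']; simp

theorem rowLen_exchangeUp_zero_and_succ (hα : IsHStrip μ α i) (hβ : IsHStrip μ β j) (k : ℕ) :
    (exchangeUp α β μ k).rowLen 0 = k + max (α.rowLen 0) (β.rowLen 0) ∧
    ∀ t, μ.rowLen t + (exchangeUp α β μ k).rowLen (t + 1) =
      min (α.rowLen t) (β.rowLen t) + max (α.rowLen (t + 1)) (β.rowLen (t + 1)) := by
  obtain ⟨N, h1, h2⟩ := exists_rowLen_eq_zero α β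
  have h1' := rowLen_eq_zero_of_le h1 N.le_succ
  have h2' := rowLen_eq_zero_of_le h2 N.le_succ
  have hle (t : ℕ) : μ.rowLen t ≤ min (α.rowLen t) (β.rowLen t) :=
    le_min (le_iff_rowLen.1 hα.1 t) (le_iff_rowLen.1 hβ.1 t)
  have hge (t : ℕ) : max (α.rowLen (t + 1)) (β.rowLen (t + 1)) ≤ μ.rowLen t :=
    max_le (hα.2.1 t) (hβ.2.1 t)
  have key (t : ℕ) : (exchangeUp α β μ k).rowLen t =
      t.casesOn (k + max (α.rowLen 0) (β.rowLen 0)) fun t =>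
        min (α.rowLen t) (β.rowLen t) + max (α.rowLen (t + 1)) (β.rowLen (t + 1)) - μ.rowLen t := by
    rw [exchangeUp, rowLen_toDiagram (N := N + 1)]
    · rintro (_ | t)
      · have := hge 0
        have := hle 0
        change min (α.rowLen 0) (β.rowLen 0) + max (α.rowLen (0 + 1)) (β.rowLen (0 + 1)) -
          μ.rowLen 0 ≤ k + max (α.rowLen 0) (β.rowLen 0)
        omega
      · have := hle t
        have := hge t
        have := hge (t + 1)
        have := hle (t + 1)
        simp only
        omega
    · simp only [h1, h2, h1', h2']; simp
  refine ⟨key 0, fun t => ?_⟩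
  rw [key (t + 1)]
  have := hle t
  simp only
  omega

theorem isHStrip_exchangeDown (hα : IsHStrip α l i) (hβ : IsHStrip β l j)
    (h0 : l.rowLen 0 = k + max (α.rowLen 0) (β.rowLen 0)) :
    k ≤ min i j ∧ IsHStrip (exchangeDown α β l) α (j - k) ∧
      IsHStrip (exchangeDown α β l) β (i - k) := by
  have hr := rowLen_exchangeDown hα hβ
  have hc := card_add_card_eq h0 hr
  have key (t : ℕ) : (exchangeDown α β l).rowLen t ≤ min (α.rowLen t) (β.rowLen t) ∧
      max (α.rowLen (t + 1)) (β.rowLen (t + 1)) ≤ (exchangeDown α β l).rowLen t := by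
    have a0 := hr t
    have a1 := hα.2.1 t
    have a2 := hβ.2.1 t
    have a3 := le_iff_rowLen.1 hα.1 (t + 1)
    have a4 := le_iff_rowLen.1 hβ.1 (t + 1)
    omega
  have leα : exchangeDown α β l ≤ α := le_iff_rowLen.2 fun t => (le_min_iff.1 (key t).1).1
  have leβ : exchangeDown α β l ≤ β := le_iff_rowLen.2 fun t => (le_min_iff.1 (key t).1).2
  have c1 := card_le_card_of_le leα
  have c2 := card_le_card_of_le leβ
  have c3 := hα.2.2
  have c4 := hβ.2.2
  refine ⟨by omega, ⟨leα, fun t => (max_le_iff.1 (key t).2).1, by omega⟩,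
    ⟨leβ, fun t => (max_le_iff.1 (key t).2).2, by omega⟩⟩

theorem isHStrip_exchangeUp (hk : k ≤ min i j) (hα : IsHStrip μ α (j - k))
    (hβ : IsHStrip μ β (i - k)) :
    IsHStrip α (exchangeUp α β μ k) i ∧ IsHStrip β (exchangeUp α β μ k) j := by
  obtain ⟨h0, hr⟩ := rowLen_exchangeUp_zero_and_succ hα hβ k
  have hc := card_add_card_eq h0 hr
  have key (t : ℕ) : (exchangeUp α β μ k).rowLen (t + 1) ≤ min (α.rowLen t) (β.rowLen t) ∧
      max (α.rowLen (t + 1)) (β.rowLen (t + 1)) ≤ (exchangeUp α β μ k).rowLen (t + 1) := by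
    have a0 := hr t
    have a1 := hα.2.1 t
    have a2 := hβ.2.1 t
    have a3 := le_iff_rowLen.1 hα.1 t
    have a4 := le_iff_rowLen.1 hβ.1 t
    omega
  have c3 := hα.2.2
  have c4 := hβ.2.2
  refine ⟨⟨le_iff_rowLen.2 ?_, fun t => (le_min_iff.1 (key t).1).1, by omega⟩,
    ⟨le_iff_rowLen.2 ?_, fun t => (le_min_iff.1 (key t).1).2, by omega⟩⟩
  · rintro (_ | t)
    · omega
    · exact (max_le_iff.1 (key t).2).1
  · rintro (_ | t)
    · omega
    · exact (max_le_iff.1 (key t).2).2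

end exchange

theorem sum_hUpper_sum_hLower {M : Type*} [AddCommMonoid M] (α : YoungDiagram) (i j : ℕ)
    (g : YoungDiagram → M) :
    ∑ l ∈ hUpper α i, ∑ β ∈ hLower l j, g β = ∑ k ∈ range (min i j + 1),
      ∑ μ ∈ hLower α (j - k), ∑ β ∈ hUpper μ (i - k), g β := by
  rw [sum_sigma', sum_congr rfl fun k _ => sum_sigma' _ _ _, sum_sigma']
  refine sum_nbij'
    (fun x => ⟨x.1.rowLen 0 - max (α.rowLen 0) (x.2.rowLen 0), ⟨exchangeDown α x.2 x.1, x.2⟩⟩)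
    (fun y => ⟨exchangeUp α y.2.2 y.2.1 y.1, y.2.2⟩) ?_ ?_ ?_ ?_ (fun _ _ => rfl)
  all_goals simp only [Sigma.forall, mem_sigma, mem_hUpper, mem_hLower, mem_range, Nat.lt_succ_iff]
  · rintro l β ⟨h1, h2⟩
    have a1 := le_iff_rowLen.1 h1.1 0
    have a2 := le_iff_rowLen.1 h2.1 0
    exact isHStrip_exchangeDown h1 h2 (by omega)
  · rintro k μ β ⟨h1, h2, h3⟩
    exact isHStrip_exchangeUp h1 h2 h3
  · rintro l β ⟨h1, h2⟩
    have a1 := le_iff_rowLen.1 h1.1 0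
    have a2 := le_iff_rowLen.1 h2.1 0
    obtain ⟨b1, b2, b3⟩ := isHStrip_exchangeDown h1 h2
      (k := l.rowLen 0 - max (α.rowLen 0) (β.rowLen 0)) (by omega)
    have hd := rowLen_exchangeDown h1 h2
    obtain ⟨e0, e1⟩ := rowLen_exchangeUp_zero_and_succ b2 b3
      (l.rowLen 0 - max (α.rowLen 0) (β.rowLen 0))
    congr 1
    refine ext_rowLen ?_
    rintro (_ | t)
    · omega
    · have := hd t
      have := e1 t
      omega
  · rintro k μ β ⟨h1, h2, h3⟩
    obtain ⟨b1, b2⟩ := isHStrip_exchangeUp h1 h2 h3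
    obtain ⟨e0, e1⟩ := rowLen_exchangeUp_zero_and_succ h2 h3 k
    have hd := rowLen_exchangeDown b1 b2
    have hk : (exchangeUp α β μ k).rowLen 0 - max (α.rowLen 0) (β.rowLen 0) = k := by omega
    have hμ : exchangeDown α β (exchangeUp α β μ k) = μ := ext_rowLen fun t => by
      have := hd t
      have := e1 t
      omega
    rw [hk, hμ]

theorem fSkew_eq_zero {mu l : YoungDiagram} {n : ℕ} {q : ℝ}
    (h : ¬ (mu ≤ l ∧ l.card = mu.card + n)) : fSkew mu l n q = 0 := by
  rw [fSkew, sum_eq_zero]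
  intro c hc
  obtain ⟨h0, h1, h2⟩ := mem_skewSYT.1 hc
  refine absurd ⟨h0 ▸ h1 ▸ h2.le_last 0, ?_⟩ h
  have key (i : ℕ) (hi : i < n + 1) : (c ⟨i, hi⟩).card = mu.card + i := by
    induction i with
    | zero => rw [← h0]; rfl
    | succ i ih => rw [(h2 i (by omega)).2, ih (by omega)]; rfl
  rw [← h1]
  exact key n (by omega)

open scoped Classical in
theorem fSkew_zero (mu l : YoungDiagram) (q : ℝ) : fSkew mu l 0 q = if mu = l then 1 else 0 := by
  split_ifs with h
  · subst h
    have : skewSYT mu mu 0 = {fun _ => mu} := by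
      ext c
      rw [mem_skewSYT, mem_singleton]
      constructor
      · rintro ⟨h, -, -⟩
        funext i
        rw [Fin.fin_one_eq_zero i, h]
      · rintro rfl
        exact ⟨rfl, rfl, fun i hi => absurd hi (by omega)⟩
    simp [fSkew, this, chainMaj]
  · refine fSkew_eq_zero fun ⟨h1, h2⟩ => h (eq_of_le_of_card_eq h1 (by omega))

/-- Sum over all diagrams obtained by adding a horizontal strip with `j` cells. -/
noncomputable def hUpOp (j : ℕ) : Module.End ℝ (YoungDiagram →₀ ℝ) :=
  Finsupp.linearCombination ℝ fun ν => ∑ l ∈ hUpper ν j, Finsupp.single l 1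

/-- Sum over all diagrams obtained by removing a horizontal strip with `j` cells. -/
noncomputable def hDownOp (j : ℕ) : Module.End ℝ (YoungDiagram →₀ ℝ) :=
  Finsupp.linearCombination ℝ fun l => ∑ κ ∈ hLower l j, Finsupp.single κ 1

/-- The operator with matrix entries `f^{l/α}(q)` from `α` to `l`. -/
noncomputable def fUpOp (q : ℝ) (n : ℕ) : Module.End ℝ (YoungDiagram →₀ ℝ) :=
  Finsupp.linearCombination ℝ fun α =>
    ∑ l ∈ diagramsOfCard (α.card + n), fSkew α l n q • Finsupp.single l 1

/-- The operator with matrix entries `f^{l/α}(q)` from `l` to `α`. -/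
noncomputable def fDownOp (q : ℝ) (n : ℕ) : Module.End ℝ (YoungDiagram →₀ ℝ) :=
  Finsupp.linearCombination ℝ fun l =>
    ∑ α ∈ subDiagrams l, fSkew α l n q • Finsupp.single α 1

theorem hUpOp_single (j : ℕ) (ν : YoungDiagram) :
    hUpOp j (Finsupp.single ν 1) = ∑ l ∈ hUpper ν j, Finsupp.single l 1 := by simp [hUpOp]

theorem hDownOp_single (j : ℕ) (l : YoungDiagram) :
    hDownOp j (Finsupp.single l 1) = ∑ κ ∈ hLower l j, Finsupp.single κ 1 := by simp [hDownOp]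

theorem fUpOp_single (q : ℝ) (n : ℕ) (α : YoungDiagram) : fUpOp q n (Finsupp.single α 1) =
    ∑ l ∈ diagramsOfCard (α.card + n), fSkew α l n q • Finsupp.single l 1 := by simp [fUpOp]

theorem fDownOp_single (q : ℝ) (n : ℕ) (l : YoungDiagram) : fDownOp q n (Finsupp.single l 1) =
    ∑ α ∈ subDiagrams l, fSkew α l n q • Finsupp.single α 1 := by simp [fDownOp]

theorem end_ext {S T : Module.End ℝ (YoungDiagram →₀ ℝ)}
    (h : ∀ ν, S (Finsupp.single ν 1) = T (Finsupp.single ν 1)) : S = T :=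
  Finsupp.lhom_ext' fun ν => LinearMap.ext_ring (h ν)

theorem fUpOp_apply (q : ℝ) (n : ℕ) (α l : YoungDiagram) :
    fUpOp q n (Finsupp.single α 1) l = fSkew α l n q := by
  classical
  rw [fUpOp_single, Finsupp.finsetSum_apply]
  simp only [Finsupp.smul_apply, Finsupp.single_apply, smul_eq_mul, mul_ite, mul_one, mul_zero]
  rw [sum_ite_eq']
  split_ifs with h
  · rfl
  · exact (fSkew_eq_zero fun h' => h (mem_diagramsOfCard.2 h'.2)).symm

theorem fDownOp_apply (q : ℝ) (n : ℕ) (l α : YoungDiagram) :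
    fDownOp q n (Finsupp.single l 1) α = fSkew α l n q := by
  classical
  rw [fDownOp_single, Finsupp.finsetSum_apply]
  simp only [Finsupp.smul_apply, Finsupp.single_apply, smul_eq_mul, mul_ite, mul_one, mul_zero]
  rw [sum_ite_eq']
  split_ifs with h
  · rfl
  · exact (fSkew_eq_zero fun h' => h (mem_subDiagrams.2 h'.1)).symm

theorem hUpOp_zero : hUpOp 0 = 1 := end_ext fun ν => by
  have : hUpper ν 0 = {ν} := by
    ext l
    rw [mem_hUpper, ← mem_hLower, hLower_zero, mem_singleton, mem_singleton, eq_comm]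
  simp [hUpOp_single, this]

theorem hDownOp_zero : hDownOp 0 = 1 := end_ext fun ν => by
  simp [hDownOp_single, hLower_zero]

theorem fUpOp_zero (q : ℝ) : fUpOp q 0 = 1 := end_ext fun ν => by
  classical
  ext l
  rw [fUpOp_apply, fSkew_zero, Module.End.one_apply, Finsupp.single_apply]

theorem fDownOp_zero (q : ℝ) : fDownOp q 0 = 1 := end_ext fun ν => by
  classical
  ext l
  rw [fDownOp_apply, fSkew_zero, Module.End.one_apply, Finsupp.single_apply]
  simp only [eq_comm]

theorem hDownOp_mul_hUpOp (i j : ℕ) : hDownOp j * hUpOp i =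
    ∑ k ∈ range (min i j + 1), hUpOp (i - k) * hDownOp (j - k) := end_ext fun α => by
  simp only [Module.End.mul_apply, LinearMap.sum_apply, hUpOp_single, hDownOp_single, map_sum]
  exact sum_hUpper_sum_hLower α i j _

theorem fUpOp_succ (q : ℝ) (n : ℕ) : fUpOp q (n + 1) =
    ∑ j ∈ range (n + 1), runCoeff q n j • (hUpOp (j + 1) * fUpOp q (n - j)) := end_ext fun α => by
  simp only [LinearMap.sum_apply, LinearMap.smul_apply, Module.End.mul_apply, fUpOp_single, map_sum,
    map_smul, hUpOp_single, fSkew_succ, sum_smul, mul_smul]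
  rw [sum_comm]
  refine sum_congr rfl fun j hj => ?_
  have hj' := mem_range.1 hj
  rw [← smul_sum]
  congr 1
  simp only [smul_sum]
  refine sum_comm' fun l κ => ?_
  simp only [mem_diagramsOfCard, mem_hLower, mem_hUpper]
  constructor
  · rintro ⟨h1, h2⟩
    have := h2.2.2
    exact ⟨h2, by omega⟩
  · rintro ⟨h1, h2⟩
    have := h1.2.2
    exact ⟨by omega, h1⟩

theorem fDownOp_succ (q : ℝ) (n : ℕ) : fDownOp q (n + 1) =
    ∑ j ∈ range (n + 1), runCoeff q n j • (fDownOp q (n - j) * hDownOp (j + 1)) :=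
  end_ext fun l => by
  ext α
  simp only [LinearMap.sum_apply, LinearMap.smul_apply, Module.End.mul_apply, hDownOp_single,
    map_sum, Finsupp.finsetSum_apply, Finsupp.smul_apply, fDownOp_apply, smul_eq_mul, fSkew_succ]

theorem eq_sum_of_succ_eq_sum_runCoeff {M : Type*} [AddCommGroup M] [Module ℝ M] {q : ℝ}
    (hq : ∀ m, 0 < m → q ^ m ≠ 1) {X : ℕ → M} {Y : ℕ → ℕ → M} (hY : ∀ n, Y n 0 = X n)
    (hX : ∀ n, X (n + 1) = ∑ j ∈ range (n + 1), runCoeff q n j • Y (n - j) (j + 1)) (n : ℕ) :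
    (qPoch q n)⁻¹ • X n = ∑ x ∈ antidiagonal n, q ^ x.1 • (qPoch q x.1)⁻¹ • Y x.1 x.2 := by
  rcases n with _ | n
  · simp [hY]
  have hQ := qPoch_ne_zero hq
  rw [Nat.sum_antidiagonal_eq_sum_range_succ
    (fun i j => q ^ i • (qPoch q i)⁻¹ • Y i j), sum_range_succ, ← sum_range_reflect]
  have h1 : ∑ j ∈ range (n + 1), q ^ (n + 1 - 1 - j) • (qPoch q (n + 1 - 1 - j))⁻¹ •
      Y (n + 1 - 1 - j) (n + 1 - (n + 1 - 1 - j)) = (qPoch q n)⁻¹ • X (n + 1) := by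
    rw [hX, smul_sum]
    refine sum_congr rfl fun j hj => ?_
    obtain ⟨l, rfl⟩ : ∃ l, n = l + j := ⟨n - j, by have := mem_range.1 hj; omega⟩
    have h2 := runCoeff_mul_qPoch q l j
    rw [show l + j + 1 - 1 - j = l by omega, show l + j + 1 - l = j + 1 by omega,
      Nat.add_sub_cancel, smul_smul, smul_smul]
    congr 1
    have a1 := hQ l
    have a2 := hQ (l + j)
    field_simp
    linear_combination -h2
  rw [h1, Nat.sub_self, hY, smul_smul, ← add_smul]
  congr 1
  have a1 := hQ n
  have a2 : 1 - q ^ (n + 1) ≠ 0 := sub_ne_zero.2 (hq _ (by omega)).symm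
  rw [qPoch_succ]
  field_simp
  ring

theorem hDownOp_mul_fUpOp {q : ℝ} (hq : ∀ m, 0 < m → q ^ m ≠ 1) (j n : ℕ) :
    hDownOp j * ((qPoch q n)⁻¹ • fUpOp q n) = ∑ k ∈ range (min j n + 1),
      (qPoch q k)⁻¹ • (((qPoch q (n - k))⁻¹ • fUpOp q (n - k)) * hDownOp (j - k)) := by
  have key := skew_commutation_lift (R := (Module.End ℝ (YoungDiagram →₀ ℝ))ᵐᵒᵖ) hq
    (P := fun n => MulOpposite.op ((qPoch q n)⁻¹ • fUpOp q n))
    (D := fun j => MulOpposite.op (hUpOp j)) (G := fun j => MulOpposite.op (hDownOp j))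
    (e := fun _ => 1) (a := fun k => (qPoch q k)⁻¹) ?_ ?_ ?_ rfl ?_ ?_ (sum_pow_div_qPoch hq) n j
  · apply MulOpposite.op_injective
    rw [MulOpposite.op_mul, key, Finset.op_sum, min_comm]
    simp
  · intro n
    rw [eq_sum_of_succ_eq_sum_runCoeff hq (Y := fun i j => hUpOp j * fUpOp q i) _ (fUpOp_succ q) n,
      Finset.op_sum]
    · simp
    · simp [hUpOp_zero]
  · simp [fUpOp_zero]
  · simp [hUpOp_zero]
  · simp
  · intro j n
    rw [← MulOpposite.op_mul, hDownOp_mul_hUpOp, Finset.op_sum]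
    simp

theorem fDownOp_mul_fUpOp {p q : ℝ} (hp : ∀ m, 0 < m → p ^ m ≠ 1)
    (hq : ∀ m, 0 < m → q ^ m ≠ 1) (m n : ℕ) :
    fDownOp p m * fUpOp q n = ∑ k ∈ range (min m n + 1),
      (qBinom p m k * qBinom q n k * Apq p q k) • (fUpOp q (n - k) * fDownOp p (m - k)) := by
  have key := skew_commutation_lift hp
    (P := fun n => (qPoch p n)⁻¹ • fDownOp p n)
    (D := hDownOp) (G := fun n => (qPoch q n)⁻¹ • fUpOp q n)
    (e := fun k => (qPoch q k)⁻¹) (a := fun k => Apq p q k / (qPoch p k * qPoch q k))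
    ?_ ?_ hDownOp_zero ?_ ?_ (hDownOp_mul_fUpOp hq) (Apq_div_qPoch hp hq) m n
  · have hP := qPoch_ne_zero hp
    have hQ := qPoch_ne_zero hq
    have e1 : fDownOp p m * fUpOp q n = (qPoch p m * qPoch q n) •
        (((qPoch p m)⁻¹ • fDownOp p m) * ((qPoch q n)⁻¹ • fUpOp q n)) := by
      rw [smul_mul_smul_comm, smul_smul]
      have a1 := hP m
      have a2 := hQ n
      rw [show qPoch p m * qPoch q n * ((qPoch p m)⁻¹ * (qPoch q n)⁻¹) = 1 by field_simp, one_smul]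
    rw [e1, key, smul_sum]
    refine sum_congr rfl fun k hk => ?_
    have hk' := mem_range.1 hk
    rw [smul_mul_smul_comm, smul_smul, smul_smul]
    congr 1
    have h1 := qBinom_mul_qPoch p k (m - k)
    have h2 := qBinom_mul_qPoch q k (n - k)
    rw [show k + (m - k) = m by omega] at h1
    rw [show k + (n - k) = n by omega] at h2
    rw [← h1, ← h2]
    have a1 := hP k
    have a2 := hQ k
    have a3 := hP (m - k)
    have a4 := hQ (n - k)
    field_simp
  · intro n
    rw [eq_sum_of_succ_eq_sum_runCoeff hp (Y := fun i j => fDownOp p i * hDownOp j) _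
      (fDownOp_succ p) n]
    · simp
    · simp [hDownOp_zero]
  · simp [fDownOp_zero]
  · simp
  · simp [Apq_zero]

open scoped Classical in
theorem sum_fSkew_mul_fSkew_of_generic (α β : YoungDiagram) (m n : ℕ) {p q : ℝ}
    (hp : ∀ m, 0 < m → p ^ m ≠ 1) (hq : ∀ m, 0 < m → q ^ m ≠ 1) :
    ∑ lam ∈ (diagramsOfCard (α.card + m)).filter
        (fun lam => α ≤ lam ∧ β ≤ lam ∧ lam.card = β.card + n),
        fSkew α lam m p * fSkew β lam n q =
      ∑ k ∈ range (min m n + 1), qBinom p m k * qBinom q n k * Apq p q k *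
        ∑ μ ∈ (subDiagrams β).filter
            (fun μ => μ ≤ α ∧ μ.card + (m - k) = β.card ∧ μ.card + (n - k) = α.card),
          fSkew μ β (m - k) p * fSkew μ α (n - k) q := by
  have key := congrArg (fun T => T (Finsupp.single β 1) α) (fDownOp_mul_fUpOp hp hq m n)
  simp only [LinearMap.sum_apply, LinearMap.smul_apply, Module.End.mul_apply,
    Finsupp.finsetSum_apply, Finsupp.smul_apply, smul_eq_mul] at key
  have e1 : fDownOp p m (fUpOp q n (Finsupp.single β 1)) α =
      ∑ l ∈ diagramsOfCard (β.card + n), fSkew α l m p * fSkew β l n q := by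
    rw [fUpOp_single, map_sum, Finsupp.finsetSum_apply]
    refine sum_congr rfl fun l _ => ?_
    rw [map_smul, Finsupp.smul_apply, fDownOp_apply, smul_eq_mul, mul_comm]
  have e2 (k : ℕ) : fUpOp q (n - k) (fDownOp p (m - k) (Finsupp.single β 1)) α =
      ∑ μ ∈ subDiagrams β, fSkew μ β (m - k) p * fSkew μ α (n - k) q := by
    rw [fDownOp_single, map_sum, Finsupp.finsetSum_apply]
    refine sum_congr rfl fun l _ => ?_
    rw [map_smul, Finsupp.smul_apply, fUpOp_apply, smul_eq_mul]
  rw [e1] at key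
  simp only [e2] at key
  trans ∑ l ∈ diagramsOfCard (β.card + n), fSkew α l m p * fSkew β l n q
  · refine sum_subset (fun l hl => ?_) fun l hl hl' => ?_
    · exact mem_diagramsOfCard.2 (mem_filter.1 hl).2.2.2
    · rw [mem_diagramsOfCard] at hl
      simp only [mem_filter, mem_diagramsOfCard] at hl'
      by_cases h : α ≤ l ∧ l.card = α.card + m
      · by_cases h' : β ≤ l ∧ l.card = β.card + n
        · exact absurd ⟨h.2, h.1, h'.1, h'.2⟩ hl'
        · rw [fSkew_eq_zero h', mul_zero]
      · rw [fSkew_eq_zero h, zero_mul]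
  · rw [key]
    refine sum_congr rfl fun k _ => ?_
    congr 1
    symm
    refine sum_subset (filter_subset _ _) fun μ hμ hμ' => ?_
    rw [mem_filter] at hμ'
    by_cases h : μ ≤ β ∧ β.card = μ.card + (m - k)
    · by_cases h' : μ ≤ α ∧ α.card = μ.card + (n - k)
      · exact absurd ⟨hμ, h'.1, h.2.symm, h'.2.symm⟩ hμ'
      · rw [fSkew_eq_zero h', mul_zero]
    · rw [fSkew_eq_zero h, zero_mul]

theorem continuous_qBinom (n k : ℕ) : Continuous fun q => qBinom q n k := by
  induction n generalizing k with
  | zero => cases k <;> exact continuous_const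
  | succ n ih =>
    cases k with
    | zero => exact continuous_const
    | succ k => exact (ih k).add ((continuous_pow _).mul (ih (k + 1)))

theorem continuous_fSkew (mu l : YoungDiagram) (n : ℕ) : Continuous fun q => fSkew mu l n q :=
  continuous_finsetSum _ fun _ _ => continuous_pow _

theorem dense_pow_ne_one : Dense {q : ℝ | ∀ m, 0 < m → q ^ m ≠ 1} := by
  refine ((Set.toFinite ({1, -1} : Set ℝ)).countable.dense_compl ℝ).mono ?_
  intro q hq m hm h
  rcases (pow_eq_one_iff_of_ne_zero hm.ne').1 h with h | ⟨h, _⟩ <;> simp [h] at hq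

open scoped Classical in
/-- For partitions `α, β` and `m, n ≥ 0`,
`Σ_{λ : λ/α ⊢ m, λ/β ⊢ n} f^{λ/α}(p) f^{λ/β}(q)
   = Σ_{k ≥ 0} [m choose k]_p [n choose k]_q A_k(p,q)
       Σ_{μ : β/μ ⊢ m-k, α/μ ⊢ n-k} f^{β/μ}(p) f^{α/μ}(q)`. -/
theorem stmt12 (α β : YoungDiagram) (m n : ℕ) (p q : ℝ) :
    ∑ lam ∈ (diagramsOfCard (α.card + m)).filter
        (fun lam => α ≤ lam ∧ β ≤ lam ∧ lam.card = β.card + n),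
        fSkew α lam m p * fSkew β lam n q =
      ∑ k ∈ Finset.range (min m n + 1), qBinom p m k * qBinom q n k * Apq p q k *
        ∑ μ ∈ (subDiagrams β).filter
            (fun μ => μ ≤ α ∧ μ.card + (m - k) = β.card ∧ μ.card + (n - k) = α.card),
          fSkew μ β (m - k) p * fSkew μ α (n - k) q := by
  have hF := continuous_fSkew
  have hB := continuous_qBinom
  have hA₁ (q : ℝ) (k : ℕ) : Continuous fun p => Apq p q k := by unfold Apq; fun_prop
  have hA₂ (p : ℝ) (k : ℕ) : Continuous fun q => Apq p q k := by unfold Apq; fun_prop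
  have key (p : ℝ) (hp : ∀ m, 0 < m → p ^ m ≠ 1) := congrFun <|
    Continuous.ext_on dense_pow_ne_one (by fun_prop) (by fun_prop) fun q hq =>
      sum_fSkew_mul_fSkew_of_generic α β m n hp hq
  exact congrFun (Continuous.ext_on dense_pow_ne_one (by fun_prop) (by fun_prop) fun p hp =>
    key p hp q) p

end QT
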